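/- Let f, g_1, …, g_m, h_1, …, h_l ∈ ℝ[x], g = (g_1,…,g_m), h = (h_1,…,h_l), and let f̄* := inf{f(x) : x ∈ S(g) ∩ V(h)}; assume f̄* is a real number. If there exists q ∈ Q(g)[x] such that f − f̄* − q vanishes on V(h), then there exists k ∈ ℕ such that ρ_k(f, g, h) = f̄*. -/

import Mathlib

open MvPolynomial

noncomputable section

/-- `p` is a sum of squares of polynomials. -/
def IsSOS {σ : Type*} (p : MvPolynomial σ ℝ) : Prop :=
  ∃ (k : ℕ) (q : Fin k → MvPolynomial σ ℝ), p = ∑ i, q i ^ 2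

/-- Membership in the quadratic module `Q(g)` generated by the tuple `g`. -/
def InQM {σ ι : Type*} [Fintype ι] (g : ι → MvPolynomial σ ℝ) (p : MvPolynomial σ ℝ) : Prop :=
  ∃ (s0 : MvPolynomial σ ℝ) (s : ι → MvPolynomial σ ℝ),
    IsSOS s0 ∧ (∀ j, IsSOS (s j)) ∧ p = s0 + ∑ j, s j * g j

/-- Membership in the truncated quadratic module `Q_k(g)` of order `k`. -/
def InTruncQM {σ ι : Type*} [Fintype ι] (k : ℕ) (g : ι → MvPolynomial σ ℝ)
    (p : MvPolynomial σ ℝ) : Prop :=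
  ∃ (s0 : MvPolynomial σ ℝ) (s : ι → MvPolynomial σ ℝ),
    IsSOS s0 ∧ (∀ j, IsSOS (s j)) ∧ s0.totalDegree ≤ 2 * k ∧
    (∀ j, (s j * g j).totalDegree ≤ 2 * k) ∧ p = s0 + ∑ j, s j * g j

/-- Membership in the truncated ideal `I_k(h)` of order `k`. -/
def InTruncId {σ ι : Type*} [Fintype ι] (k : ℕ) (h : ι → MvPolynomial σ ℝ)
    (p : MvPolynomial σ ℝ) : Prop :=
  ∃ ps : ι → MvPolynomial σ ℝ, (∀ t, (ps t * h t).totalDegree ≤ 2 * k) ∧ p = ∑ t, ps t * h t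

/-- The value `ρ_k(f, g, h)` of the SOS relaxation of order `k`. -/
def rho {σ ι κ : Type*} [Fintype ι] [Fintype κ] (k : ℕ) (f : MvPolynomial σ ℝ)
    (g : ι → MvPolynomial σ ℝ) (h : κ → MvPolynomial σ ℝ) : ℝ :=
  sSup {ξ : ℝ | ∃ q1 q2, InTruncQM k g q1 ∧ InTruncId k h q2 ∧ f - C ξ = q1 + q2}

/-- The basic semi-algebraic set `S(g)`. -/
def Sg {n m : ℕ} (g : Fin m → MvPolynomial (Fin n) ℝ) : Set (Fin n → ℝ) :=
  {x | ∀ j, 0 ≤ eval x (g j)}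

/-- The real variety `V(h)` of a tuple of polynomials. -/
def Vh {n l : ℕ} (h : Fin l → MvPolynomial (Fin n) ℝ) : Set (Fin n → ℝ) :=
  {x | ∀ t, eval x (h t) = 0}

namespace Polynomial

section ComplexLike

variable {F Ω : Type*} [Field F] [LinearOrder F] [IsStrictOrderedRing F] [Field Ω] [IsAlgClosed Ω]
  [Algebra F Ω] {I : Ω}

/-- A monic polynomial over an ordered field whose extension by a square root of `-1` is
algebraically closed is a product of linear factors and positive definite quadratic factors. -/
theorem exists_factorization_of_monic (hI : I ^ 2 = -1)
    (hspan : ∀ z : Ω, ∃ a b : F, z = algebraMap F Ω a + algebraMap F Ω b * I)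
    (M : F[X]) (hM : M.Monic) :
    ∃ (rs : Multiset F) (qs : Multiset (F × F)), (∀ q ∈ qs, q.2 ≠ 0) ∧
      M = (rs.map fun r => X - C r).prod *
        (qs.map fun q => (X - C q.1) ^ 2 + C (q.2 ^ 2)).prod := by
  induction hn : M.natDegree using Nat.strong_induction_on generalizing M with
  | _ n ih =>
  rcases Nat.eq_zero_or_pos n with h0 | hpos
  · exact ⟨0, 0, by simp, by simpa using hM.natDegree_eq_zero.1 (hn.trans h0)⟩
  obtain ⟨z, hz⟩ := IsAlgClosed.exists_aeval_eq_zero Ω M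
    (by rw [degree_eq_natDegree hM.ne_zero]; exact_mod_cast (by omega))
  obtain ⟨a, b, rfl⟩ := hspan z
  by_cases hb : b = 0
  · subst hb
    have hr : M.IsRoot a := by
      have : algebraMap F Ω (M.eval a) = 0 := by
        simpa [aeval_algebraMap_apply, aeval_def, eval₂_at_apply] using hz
      simpa using this
    obtain ⟨N, rfl⟩ := dvd_iff_isRoot.2 hr
    have hN : N.Monic := (monic_X_sub_C a).of_mul_monic_left hM
    obtain ⟨rs, qs, hq, hNfac⟩ := ih N.natDegree (by
      rw [← hn, (monic_X_sub_C a).natDegree_mul hN]; simp) N hN rfl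
    exact ⟨a ::ₘ rs, qs, hq, by rw [Multiset.map_cons, Multiset.prod_cons, mul_assoc, ← hNfac]⟩
  · set Q : F[X] := (X - C a) ^ 2 + C (b ^ 2) with hQ
    have hdeg : ((X - C a) ^ 2 : F[X]).degree = 2 := by simp [degree_pow]
    have hlt : (C (b ^ 2)).degree < ((X - C a) ^ 2 : F[X]).degree := by
      rw [hdeg]; exact degree_C_le.trans_lt (by norm_num)
    have hQm : Q.Monic := ((monic_X_sub_C a).pow 2).add_of_left hlt
    have hQd : Q.natDegree = 2 := by
      apply natDegree_eq_of_degree_eq_some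
      rw [hQ, degree_add_eq_left_of_degree_lt hlt, hdeg]; rfl
    have hQz : aeval (algebraMap F Ω a + algebraMap F Ω b * I) Q = 0 := by
      simp [hQ, mul_pow, hI]
    have hdvd : Q ∣ M := by
      rw [← modByMonic_eq_zero_iff_dvd hQm]
      have hrem : aeval (algebraMap F Ω a + algebraMap F Ω b * I) (M %ₘ Q) = 0 := by
        rw [← hz, aeval_modByMonic_eq_self_of_root hQz]
      have hrd : (M %ₘ Q).degree ≤ 1 := by
        have := degree_modByMonic_lt M hQm
        rw [degree_eq_natDegree hQm.ne_zero, hQd] at this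
        exact Order.le_of_lt_succ this
      obtain ⟨u, v, huv⟩ := exists_eq_X_add_C_of_natDegree_le_one
        (natDegree_le_of_degree_le hrd)
      rw [huv] at hrem ⊢
      simp only [map_add, map_mul, aeval_C, aeval_X] at hrem
      have key : algebraMap F Ω ((u * a + v) ^ 2 + (u * b) ^ 2) = 0 := by
        simp only [map_add, map_pow, map_mul]
        linear_combination (algebraMap F Ω u * algebraMap F Ω a + algebraMap F Ω v -
          algebraMap F Ω u * algebraMap F Ω b * I) * hrem
          + algebraMap F Ω u ^ 2 * algebraMap F Ω b ^ 2 * hI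
      rw [map_eq_zero] at key
      have h1 : u * b = 0 := by nlinarith [sq_nonneg (u * a + v), sq_nonneg (u * b)]
      have hu : u = 0 := (mul_eq_zero.1 h1).resolve_right hb
      subst hu
      have hv : v = 0 := by simpa using key
      simp [hv]
    obtain ⟨N, rfl⟩ := hdvd
    have hN : N.Monic := hQm.of_mul_monic_left hM
    obtain ⟨rs, qs, hq, hNfac⟩ := ih N.natDegree (by
      rw [← hn, hQm.natDegree_mul hN]; omega) N hN rfl
    refine ⟨rs, (a, b) ::ₘ qs, ?_, ?_⟩
    · simpa [hb] using fun x y => hq (x, y)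
    · rw [Multiset.map_cons, Multiset.prod_cons, mul_left_comm, ← hNfac]

/-- The intermediate value property of polynomials. -/
theorem eval_mul_eval_pos_of_no_root (hI : I ^ 2 = -1)
    (hspan : ∀ z : Ω, ∃ a b : F, z = algebraMap F Ω a + algebraMap F Ω b * I)
    (M : F[X]) {a b : F} (hM : ∀ c ∈ Set.uIcc a b, M.eval c ≠ 0) :
    0 < M.eval a * M.eval b := by
  have hM0 : M ≠ 0 := by rintro rfl; exact hM a Set.left_mem_uIcc (by simp)
  obtain ⟨rs, qs, hq, hfac⟩ := exists_factorization_of_monic hI hspan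
    (M * C M.leadingCoeff⁻¹) (monic_mul_leadingCoeff_inv hM0)
  have hlc : M.leadingCoeff ≠ 0 := leadingCoeff_ne_zero.2 hM0
  have hM' : ∀ c, M.eval c = M.leadingCoeff * ((rs.map fun r => c - r).prod *
      (qs.map fun q => (c - q.1) ^ 2 + q.2 ^ 2).prod) := by
    intro c
    have := congrArg (eval c) hfac
    simp only [eval_mul, eval_C, eval_multiset_prod, Multiset.map_map, Function.comp_def,
      eval_sub, eval_X, eval_add, eval_pow] at this
    rw [← this]; field_simp
  have hpos : ∀ c, 0 < (qs.map fun q => (c - q.1) ^ 2 + q.2 ^ 2).prod := fun c => by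
    refine Multiset.prod_induction (0 < ·) _ (fun _ _ => mul_pos) one_pos ?_
    simp only [Multiset.mem_map]
    rintro _ ⟨q, hqs, rfl⟩
    have := hq q hqs
    positivity
  have hlin : 0 < (rs.map fun r => (a - r) * (b - r)).prod := by
    refine Multiset.prod_induction (0 < ·) _ (fun _ _ => mul_pos) one_pos ?_
    simp only [Multiset.mem_map]
    rintro _ ⟨r, hr, rfl⟩
    by_contra hle
    refine hM r ?_ ?_
    · rw [not_lt, mul_nonpos_iff] at hle
      rw [Set.mem_uIcc]
      rcases hle with h | h
      · right; constructor <;> linarith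
      · left; constructor <;> linarith
    · rw [hM', Multiset.prod_eq_zero (Multiset.mem_map.2 ⟨r, hr, sub_self r⟩)]
      simp
  rw [Multiset.prod_map_mul] at hlin
  rw [hM' a, hM' b]
  have := mul_pos (mul_pos (pow_pos (abs_pos.2 hlc) 2) hlin) (mul_pos (hpos a) (hpos b))
  rw [sq_abs] at this
  convert this using 1
  ring

end ComplexLike

section Hermite

theorem exists_ne_zero_supportedOn_of_card_lt {F : Type*} [Field F] {n : ℕ} {ι : Type*} [Fintype ι]
    (L : (Fin n → F) →ₗ[F] (ι → F)) (T : Finset (Fin n)) (hT : Fintype.card ι < T.card) :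
    ∃ w : Fin n → F, w ≠ 0 ∧ (∀ i ∉ T, w i = 0) ∧ L w = 0 := by
  let e : (T → F) →ₗ[F] (Fin n → F) := Function.ExtendByZero.linearMap F ((↑) : T → Fin n)
  have he : ∀ (u : T → F) (i : T), e u i = u i := fun u i =>
    Subtype.val_injective.extend_apply u 0 i
  obtain ⟨u, hu, hu0⟩ := (Submodule.ne_bot_iff _).1
    (LinearMap.ker_ne_bot_of_finrank_lt (f := L ∘ₗ e) (by simpa using hT))
  refine ⟨e u, fun h => hu0 (_root_.funext fun i => ?_), fun i hi => ?_, by simpa using hu⟩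
  · rw [← he u i, h]; rfl
  · exact Function.extend_apply' _ _ _ (by simpa using hi)

open Matrix in
theorem dotProduct_mulVec_of_diagonal_congruence {F : Type*} [Field F] {n : ℕ}
    {H P : Matrix (Fin n) (Fin n) F} {d : Fin n → F} (hP : Pᵀ * H * P = Matrix.diagonal d)
    (w : Fin n → F) : (P *ᵥ w) ⬝ᵥ (H *ᵥ (P *ᵥ w)) = ∑ i, d i * w i ^ 2 := by
  have h : (P *ᵥ w) ⬝ᵥ (H *ᵥ (P *ᵥ w)) = w ⬝ᵥ ((Pᵀ * H * P) *ᵥ w) := by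
    rw [Matrix.mul_assoc, ← Matrix.mulVec_mulVec, ← Matrix.mulVec_mulVec,
      Matrix.mulVec_transpose, dotProduct_comm w, ← Matrix.dotProduct_mulVec, dotProduct_comm]
  rw [h, hP]
  simp only [dotProduct, Matrix.mulVec_diagonal]
  exact Finset.sum_congr rfl fun i _ => by ring

variable {F Ω : Type*} [Field F] [Field Ω] [Algebra F Ω] {I : Ω}

theorem exists_pow_add_mul_eq (hI : I ^ 2 = -1) (q : F × F) (k : ℕ) :
    ∃ A B : F, (algebraMap F Ω q.1 + algebraMap F Ω q.2 * I) ^ k =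
      algebraMap F Ω A + algebraMap F Ω B * I ∧
      (algebraMap F Ω q.1 - algebraMap F Ω q.2 * I) ^ k =
      algebraMap F Ω A - algebraMap F Ω B * I := by
  induction k with
  | zero => exact ⟨1, 0, by simp⟩
  | succ k ih =>
    obtain ⟨A, B, h1, h2⟩ := ih
    refine ⟨A * q.1 - B * q.2, A * q.2 + B * q.1, ?_, ?_⟩
    · rw [pow_succ, h1]
      simp only [map_sub, map_add, map_mul]
      linear_combination algebraMap F Ω B * algebraMap F Ω q.2 * hI
    · rw [pow_succ, h2]
      simp only [map_sub, map_add, map_mul]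
      linear_combination algebraMap F Ω B * algebraMap F Ω q.2 * hI

variable [LinearOrder F] [IsStrictOrderedRing F] [IsAlgClosed Ω]

/-- `H` is the Hermite matrix of the monic polynomial `M`: its entries are the power sums of the
roots of `M`. -/
def IsHermiteMatrix (Ω : Type*) [Field Ω] [Algebra F Ω] (M : F[X]) {n : ℕ}
    (H : Matrix (Fin n) (Fin n) F) : Prop :=
  ∀ s : Multiset Ω, Multiset.card s = n →
    M.map (algebraMap F Ω) = (s.map fun z => X - C z).prod →
    ∀ i j, algebraMap F Ω (H i j) = (s.map (· ^ (i.1 + j.1))).sum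

open Matrix in
/-- The Hermite form as a difference of sums of squares: a real root contributes one square, a pair
of complex conjugate roots contributes a hyperbolic plane. -/
theorem exists_hermite_decomposition (hI : I ^ 2 = -1)
    (hspan : ∀ z : Ω, ∃ a b : F, z = algebraMap F Ω a + algebraMap F Ω b * I)
    {M : F[X]} (hM : M.Monic) {n : ℕ} (hn : M.natDegree = n) {H : Matrix (Fin n) (Fin n) F}
    (hH : IsHermiteMatrix Ω M H) :
    ∃ (rs : Multiset F) (qs : Multiset (F × F)) (re im : F × F → (Fin n → F) →ₗ[F] F),
      Multiset.card rs + 2 * Multiset.card qs = n ∧ (∀ r, M.IsRoot r ↔ r ∈ rs) ∧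
      (∀ v, v ⬝ᵥ (H *ᵥ v) = (rs.map fun r => (∑ i, v i * r ^ i.1) ^ 2).sum +
        2 * ((qs.map fun q => re q v ^ 2).sum - (qs.map fun q => im q v ^ 2).sum)) ∧
      (M.Separable → ∀ v, (∀ r ∈ rs, ∑ i, v i * r ^ i.1 = 0) →
        (∀ q ∈ qs, re q v = 0 ∧ im q v = 0) → v = 0) := by
  obtain ⟨rs, qs, hq, hfac⟩ := exists_factorization_of_monic hI hspan M hM
  choose A B hAB hAB' using fun (q : F × F) k => exists_pow_add_mul_eq (I := I) hI q k
  let lin : (ℕ → F) → (Fin n → F) →ₗ[F] F := fun c =>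
    ∑ i : Fin n, c i.1 • LinearMap.proj i
  have hlin : ∀ c v, lin c v = ∑ i, v i * c i.1 := fun c v => by
    simp [lin, mul_comm]
  let ι := algebraMap F Ω
  let s : Multiset Ω := rs.map ι + (qs.map (fun q => ι q.1 + ι q.2 * I) +
    qs.map (fun q => ι q.1 - ι q.2 * I))
  have hs : M.map ι = (s.map fun z => X - C z).prod := by
    rw [hfac]
    simp only [s, Multiset.map_add, Multiset.prod_add, Multiset.map_map, Polynomial.map_mul,
      Polynomial.map_multiset_prod, Function.comp_def, Polynomial.map_sub, Polynomial.map_add,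
      Polynomial.map_pow, Polynomial.map_X, Polynomial.map_C]
    rw [← Multiset.prod_map_mul]
    congr 3
    ext1 q
    have hC : (C I : Polynomial Ω) ^ 2 = -1 := by rw [← C_pow, hI]; simp
    simp only [map_add, map_sub, map_mul, map_pow]
    linear_combination (C (ι q.2)) ^ 2 * hC
  have hcard : Multiset.card s = n := by
    rw [← hn, ← natDegree_map ι, hs, natDegree_multiset_prod_X_sub_C_eq_card]
  have hev : ∀ (v : Fin n → F) (q : F × F),
      ∑ i, ι (v i) * (ι q.1 + ι q.2 * I) ^ i.1 = ι (lin (A q) v) + ι (lin (B q) v) * I := by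
    intro v q
    simp only [hlin, map_sum, map_mul, Finset.sum_mul, ← Finset.sum_add_distrib]
    refine Finset.sum_congr rfl fun i _ => ?_
    rw [hAB q i]; ring
  have hev' : ∀ (v : Fin n → F) (q : F × F),
      ∑ i, ι (v i) * (ι q.1 - ι q.2 * I) ^ i.1 = ι (lin (A q) v) - ι (lin (B q) v) * I := by
    intro v q
    simp only [hlin, map_sum, map_mul, Finset.sum_mul, ← Finset.sum_sub_distrib]
    refine Finset.sum_congr rfl fun i _ => ?_
    rw [hAB' q i]; ring
  have hform : ∀ v : Fin n → F, ι (v ⬝ᵥ (H *ᵥ v)) =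
      (s.map fun z => (∑ i, ι (v i) * z ^ i.1) ^ 2).sum := by
    intro v
    have hsq : ∀ z : Ω, (∑ i, ι (v i) * z ^ i.1) ^ 2 =
        ∑ i, ∑ j, ι (v i) * ι (v j) * z ^ (i.1 + j.1) := by
      intro z
      rw [sq, Finset.sum_mul_sum]
      refine Finset.sum_congr rfl fun i _ => Finset.sum_congr rfl fun j _ => ?_
      ring
    simp only [hsq, dotProduct, Matrix.mulVec, Finset.mul_sum, map_sum,
      map_mul]
    rw [Multiset.sum_map_sum]
    refine Finset.sum_congr rfl fun i _ => ?_
    rw [Multiset.sum_map_sum]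
    refine Finset.sum_congr rfl fun j _ => ?_
    rw [Multiset.sum_map_mul_left, ← hH s hcard hs i j]
    ring
  refine ⟨rs, qs, fun q => lin (A q), fun q => lin (B q), ?_, ?_, ?_, ?_⟩
  · rw [← hcard]; simp [s]; ring
  · intro r
    have hne : (qs.map fun q => (r - q.1) ^ 2 + q.2 ^ 2).prod ≠ 0 := by
      refine Multiset.prod_ne_zero fun h => ?_
      obtain ⟨q, hqs, h0⟩ := Multiset.mem_map.1 h
      have := hq q hqs
      have : 0 < q.2 ^ 2 := by positivity
      nlinarith [sq_nonneg (r - q.1)]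
    rw [IsRoot, hfac]
    simp only [eval_mul, eval_multiset_prod, Multiset.map_map, Function.comp_def, eval_sub, eval_X,
      eval_C, eval_add, eval_pow, mul_eq_zero, hne, or_false, Multiset.prod_eq_zero_iff,
      Multiset.mem_map, sub_eq_zero]
    exact ⟨fun ⟨a, ha, hra⟩ => hra ▸ ha, fun h => ⟨r, h, rfl⟩⟩
  · intro v
    apply ι.injective
    rw [hform]
    simp only [s, Multiset.map_add, Multiset.sum_add, Multiset.map_map, Function.comp_def,
      hev, hev', map_add, map_mul, map_sub, map_multiset_sum, map_pow, map_sum]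
    rw [← Multiset.sum_map_add, ← Multiset.sum_map_sub, map_ofNat, ← Multiset.sum_map_mul_left]
    congr 3
    ext1 q
    linear_combination 2 * ι (lin (B q) v) ^ 2 * hI
  · intro hsep v hr hqv
    have hnodup : s.Nodup := by
      have := nodup_roots (hsep.map (f := ι))
      rwa [hs, roots_multiset_prod_X_sub_C] at this
    have hz : ∀ z ∈ s, ∑ i, ι (v i) * z ^ i.1 = 0 := by
      intro z hz
      simp only [s, Multiset.mem_add, Multiset.mem_map] at hz
      rcases hz with ⟨r, hrs, rfl⟩ | ⟨q, hqs, rfl⟩ | ⟨q, hqs, rfl⟩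
      · rw [← map_zero ι, ← hr r hrs]; simp
      · rw [hev, (hqv q hqs).1, (hqv q hqs).2]; simp
      · rw [hev', (hqv q hqs).1, (hqv q hqs).2]; simp
    have hp : (∑ i : Fin n, C (ι (v i)) * X ^ i.1 : Polynomial Ω) = 0 := by
      classical
      refine eq_zero_of_degree_lt_of_eval_finset_eq_zero s.toFinset ?_ fun z hzs => ?_
      · rw [Multiset.toFinset_card_of_nodup hnodup, hcard]
        exact degree_sum_fin_lt _
      · simpa [eval_finsetSum] using hz z (by simpa using hzs)
    ext i
    have := congrArg (coeff · i.1) hp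
    simpa [finsetSum_coeff, coeff_C_mul, coeff_X_pow, Fin.val_inj] using this

open Matrix in
theorem two_mul_card_pos_le_of_no_root (hI : I ^ 2 = -1)
    (hspan : ∀ z : Ω, ∃ a b : F, z = algebraMap F Ω a + algebraMap F Ω b * I)
    {M : F[X]} (hM : M.Monic) {n : ℕ} (hn : M.natDegree = n) {H : Matrix (Fin n) (Fin n) F}
    (hH : IsHermiteMatrix Ω M H) {P : Matrix (Fin n) (Fin n) F} {d : Fin n → F}
    (hd : Pᵀ * H * P = Matrix.diagonal d) (hroot : ∀ r, ¬ M.IsRoot r) :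
    2 * (Finset.univ.filter fun i => 0 < d i).card ≤ n := by
  classical
  obtain ⟨rs, qs, re, im, hcard, hrs, hform, -⟩ := exists_hermite_decomposition hI hspan hM hn hH
  obtain rfl : rs = 0 := Multiset.eq_zero_of_forall_notMem fun r hr => hroot r ((hrs r).2 hr)
  by_contra! hlt
  obtain ⟨w, hw0, hwT, hw⟩ := exists_ne_zero_supportedOn_of_card_lt
    (LinearMap.pi fun q : qs.toFinset => re q.1 ∘ₗ P.mulVecLin)
    (Finset.univ.filter fun i => 0 < d i) (by
      have := Multiset.toFinset_card_le qs
      simp only [Fintype.card_coe, Multiset.card_zero] at *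
      omega)
  have hw' : ∀ q ∈ qs, re q (P *ᵥ w) = 0 := fun q hq => by
    simpa using congrFun hw ⟨q, by simpa using hq⟩
  have h1 := dotProduct_mulVec_of_diagonal_congruence hd w
  rw [hform, Multiset.map_congr (f := fun q => re q (P *ᵥ w) ^ 2) (g := fun _ => (0 : F)) rfl
    fun q hq => by rw [hw' q hq]; simp] at h1
  have h2 : 0 < ∑ i, d i * w i ^ 2 := by
    obtain ⟨j, hj⟩ := Function.ne_iff.1 hw0
    refine Finset.sum_pos' (fun i _ => ?_) ⟨j, Finset.mem_univ j, ?_⟩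
    · by_cases hi : 0 < d i
      · positivity
      · simp [hwT i (by simpa using hi)]
    · have hdj : 0 < d j := by
        by_contra hi
        exact hj (hwT j (by simpa using hi))
      have : w j ≠ 0 := hj
      positivity
  have h3 : 0 ≤ (qs.map fun q => im q (P *ᵥ w) ^ 2).sum :=
    Multiset.sum_nonneg fun x hx => by
      obtain ⟨q, -, rfl⟩ := Multiset.mem_map.1 hx
      positivity
  simp at h1
  linarith

open Matrix in
theorem two_mul_card_nonpos_lt_of_root (hI : I ^ 2 = -1)
    (hspan : ∀ z : Ω, ∃ a b : F, z = algebraMap F Ω a + algebraMap F Ω b * I)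
    {M : F[X]} (hM : M.Monic) {n : ℕ} (hn : M.natDegree = n) {H : Matrix (Fin n) (Fin n) F}
    (hH : IsHermiteMatrix Ω M H) {P : Matrix (Fin n) (Fin n) F} {d : Fin n → F}
    (hP : P.det ≠ 0) (hd : Pᵀ * H * P = Matrix.diagonal d) (hsep : M.Separable) {r : F}
    (hroot : M.IsRoot r) :
    2 * (Finset.univ.filter fun i => d i ≤ 0).card < n := by
  classical
  obtain ⟨rs, qs, re, im, hcard, hrs, hform, hzero⟩ :=
    exists_hermite_decomposition hI hspan hM hn hH
  have hpos : 0 < Multiset.card rs := Multiset.card_pos_iff_exists_mem.2 ⟨r, (hrs r).1 hroot⟩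
  by_contra! hlt
  obtain ⟨w, hw0, hwT, hw⟩ := exists_ne_zero_supportedOn_of_card_lt
    (LinearMap.pi fun q : qs.toFinset => im q.1 ∘ₗ P.mulVecLin)
    (Finset.univ.filter fun i => d i ≤ 0) (by
      have := Multiset.toFinset_card_le qs
      simp only [Fintype.card_coe]
      omega)
  have hw' : ∀ q ∈ qs, im q (P *ᵥ w) = 0 := fun q hq => by
    simpa using congrFun hw ⟨q, by simpa using hq⟩
  have h1 := dotProduct_mulVec_of_diagonal_congruence hd w
  rw [hform, Multiset.map_congr (g := fun _ => (0 : F)) (f := fun q => im q (P *ᵥ w) ^ 2) rfl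
    fun q hq => by rw [hw' q hq]; simp] at h1
  have h2 : ∑ i, d i * w i ^ 2 ≤ 0 := by
    refine Finset.sum_nonpos fun i _ => ?_
    by_cases hi : d i ≤ 0
    · exact mul_nonpos_of_nonpos_of_nonneg hi (sq_nonneg _)
    · simp [hwT i (by simpa using hi)]
  have h3 : ∀ x ∈ qs.map fun q => re q (P *ᵥ w) ^ 2, 0 ≤ x := fun x hx => by
    obtain ⟨q, -, rfl⟩ := Multiset.mem_map.1 hx
    positivity
  have h4 : ∀ x ∈ rs.map fun r => (∑ i, (P *ᵥ w) i * r ^ i.1) ^ 2, 0 ≤ x := fun x hx => by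
    obtain ⟨q, -, rfl⟩ := Multiset.mem_map.1 hx
    positivity
  have h3' := Multiset.sum_nonneg h3
  have h4' := Multiset.sum_nonneg h4
  simp only [Multiset.map_const', Multiset.sum_replicate, smul_zero, sub_zero] at h1
  have h5 := (Multiset.all_zero_of_le_zero_le_of_sum_eq_zero h3 (by linarith))
  have h6 := (Multiset.all_zero_of_le_zero_le_of_sum_eq_zero h4 (by linarith))
  have h7 := hzero hsep (P *ᵥ w)
    (fun r hr => by simpa using h6 _ (Multiset.mem_map_of_mem _ hr))
    (fun q hq => ⟨by simpa using h5 _ (Multiset.mem_map_of_mem _ hq), hw' q hq⟩)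
  exact hw0 (Matrix.eq_zero_of_mulVec_eq_zero hP h7)

end Hermite

/-- Power sums of the roots of a monic polynomial are given by universal expressions in its
coefficients. -/
theorem exists_powerSum {A Ω : Type*} [CommRing A] [CommRing Ω] (m : A[X]) (k : ℕ) :
    ∃ S : A, ∀ (φ : A →+* Ω) (s : Multiset Ω), Multiset.card s = m.natDegree →
      m.map φ = (s.map fun z => X - C z).prod → φ S = (s.map (· ^ k)).sum := by
  set n := m.natDegree with hn
  obtain ⟨P, hP⟩ := MvPolynomial.esymmAlgHom_surjective (σ := Fin n) (n := n) ℤ (by simp)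
    ⟨MvPolynomial.psum (Fin n) ℤ k, MvPolynomial.psum_isSymmetric _ _ _⟩
  have hP' := congrArg Subtype.val hP
  rw [MvPolynomial.esymmAlgHom_apply] at hP'
  refine ⟨MvPolynomial.aeval
    (fun i : Fin n => (-1) ^ (i.1 + 1) * m.coeff (n - (i.1 + 1))) P, fun φ s hs hm => ?_⟩
  obtain ⟨f, rfl⟩ : ∃ f : Fin n → Ω, Finset.univ.val.map f = s := by
    obtain ⟨l, rfl⟩ := Quot.exists_rep s
    have hl : l.length = n := hs
    refine ⟨fun i => l.get (i.cast hl.symm), ?_⟩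
    clear_value n
    subst hl
    simp [Fin.univ_def]
  have hcoeff : ∀ i : Fin n, φ ((-1) ^ (i.1 + 1) * m.coeff (n - (i.1 + 1))) =
      MvPolynomial.aeval f (MvPolynomial.esymm (Fin n) ℤ (i.1 + 1)) := by
    intro i
    have h1 := congrArg (coeff · (n - (i.1 + 1))) hm
    simp only [coeff_map] at h1
    rw [Multiset.prod_X_sub_C_coeff _ (by rw [hs]; omega), hs,
      show n - (n - (i.1 + 1)) = i.1 + 1 by omega] at h1
    rw [MvPolynomial.aeval_esymm_eq_multiset_esymm, map_mul, h1, map_pow, map_neg, map_one,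
      ← mul_assoc, ← mul_pow]
    simp
  have h2 := congrArg (MvPolynomial.aeval f) hP'
  simp only [MvPolynomial.psum, map_sum, map_pow, MvPolynomial.aeval_X] at h2
  rw [MvPolynomial.comp_aeval_apply] at h2
  rw [Multiset.map_map]
  change _ = ∑ i, f i ^ k
  rw [← h2]
  have : φ (MvPolynomial.aeval
      (fun i : Fin n => (-1) ^ (i.1 + 1) * m.coeff (n - (i.1 + 1))) P) =
      (φ.toIntAlgHom : A →ₐ[ℤ] Ω) (MvPolynomial.aeval
      (fun i : Fin n => (-1) ^ (i.1 + 1) * m.coeff (n - (i.1 + 1))) P) := rfl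
  rw [this, MvPolynomial.comp_aeval_apply]
  congr 2
  ext i
  exact hcoeff i

open Matrix in
/-- A symmetric matrix over a domain of characteristic zero is diagonalised by a congruence
which is invertible over the field of fractions. -/
theorem exists_diagonal_congruence {A : Type*} [CommRing A] [IsDomain A] [CharZero A] {n : ℕ}
    (H : Matrix (Fin n) (Fin n) A) (hH : H.IsSymm) :
    ∃ (P : Matrix (Fin n) (Fin n) A) (d : Fin n → A),
      P.det ≠ 0 ∧ Pᵀ * H * P = Matrix.diagonal d := by
  let K := FractionRing A
  have hinj : Function.Injective (algebraMap A K) := IsFractionRing.injective A K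
  have : CharZero K := charZero_of_injective_algebraMap hinj
  have : Invertible (2 : K) := invertibleOfNonzero two_ne_zero
  let H' : Matrix (Fin n) (Fin n) K := H.map (algebraMap A K)
  have hB : LinearMap.IsSymm (Matrix.toBilin' H') := by
    refine ⟨fun x y => ?_⟩
    have : H'ᵀ = H' := by rw [← Matrix.transpose_map, hH.eq]
    simp only [Matrix.toBilin'_apply', RingHom.id_apply]
    rw [Matrix.dotProduct_mulVec, ← Matrix.mulVec_transpose, this, dotProduct_comm]
  obtain ⟨v, hv⟩ := LinearMap.BilinForm.exists_orthogonal_basis hB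
  let w : Module.Basis (Fin n) K (Fin n → K) := v.reindex (finCongr (by simp))
  have hw : ∀ i j, i ≠ j → Matrix.toBilin' H' (w i) (w j) = 0 := by
    intro i j hij
    simp only [w, Module.Basis.reindex_apply]
    exact hv (by simpa using hij)
  obtain ⟨c, hc⟩ := IsLocalization.exist_integer_multiples_of_finite (nonZeroDivisors A)
    (fun p : Fin n × Fin n => w p.2 p.1)
  choose Q hQ using hc
  let P : Matrix (Fin n) (Fin n) A := Matrix.of fun i j => Q (i, j)
  let W : Matrix (Fin n) (Fin n) K := Matrix.of fun i j => w j i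
  have hPW : P.map (algebraMap A K) = algebraMap A K c • W := by
    ext i j
    simp [P, W, hQ, Algebra.smul_def]
  have hWdet : W.det ≠ 0 := by
    have : W = (Pi.basisFun K (Fin n)).toMatrix w := by
      ext i j; simp [W, Module.Basis.toMatrix_apply]
    rw [this]
    have h := (Pi.basisFun K (Fin n)).toMatrix_mul_toMatrix_flip w
    intro h0
    have := congrArg Matrix.det h
    rw [Matrix.det_mul, h0] at this
    simp at this
  refine ⟨P, fun i => (Pᵀ * H * P) i i, ?_, ?_⟩
  · intro h0
    have h1 : (P.map (algebraMap A K)).det = 0 := by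
      have := RingHom.map_det (algebraMap A K) P
      rw [h0, map_zero] at this
      exact this.symm
    rw [hPW, Matrix.det_smul] at h1
    exact (mul_ne_zero (pow_ne_zero _ (by simp)) hWdet) h1
  · ext i j
    by_cases hij : i = j
    · subst hij; simp
    rw [Matrix.diagonal_apply_ne _ hij]
    apply hinj
    have h1 : (Pᵀ * H * P).map (algebraMap A K) = (algebraMap A K c) ^ 2 • (Wᵀ * H' * W) := by
      rw [Matrix.map_mul, Matrix.map_mul, Matrix.transpose_map, hPW]
      rw [Matrix.transpose_smul, Matrix.smul_mul, Matrix.smul_mul, Matrix.mul_smul, smul_smul, sq]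
    have h2 := congrFun (congrFun h1 i) j
    rw [Matrix.map_apply] at h2
    rw [h2, map_zero, Matrix.smul_apply]
    have h3 := hw i j hij
    rw [Matrix.toBilin'_apply'] at h3
    have h4 : (Wᵀ * H' * W) i j = w i ⬝ᵥ H' *ᵥ w j := by
      rw [Matrix.mul_assoc, Matrix.mul_apply']
      rfl
    rw [h4, h3, smul_zero]

section Presentation

theorem exists_primitive_presentation {A F σ : Type*} [CommRing A] [IsDomain A]
    [IsIntegrallyClosed A] [CharZero A] [Field F] [Algebra A F] [FaithfulSMul A F] [Finite σ]
    (x : σ → F) (hx : ∀ i, IsAlgebraic A (x i)) :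
    ∃ (α : F) (m : A[X]) (b : A) (P : σ → A[X]), b ≠ 0 ∧ m.Monic ∧ aeval α m = 0 ∧
      (m.map (algebraMap A F)).Separable ∧ (∀ G : A[X], aeval α G = 0 → m ∣ G) ∧
      ∀ i, aeval α (P i) = algebraMap A F b * x i := by
  classical
  let K := FractionRing A
  let _ : Algebra K F := FractionRing.liftAlgebra A F
  have : IsScalarTower A K F := FractionRing.isScalarTower_liftAlgebra A F
  have hxK : ∀ i, IsIntegral K (x i) := fun i =>
    ((IsFractionRing.isAlgebraic_iff A K F).1 (hx i)).isIntegral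
  have : CharZero K := IsFractionRing.charZero A
  let L := IntermediateField.adjoin K (Set.range x)
  have : FiniteDimensional K L := IntermediateField.finiteDimensional_adjoin (by
    rintro _ ⟨i, rfl⟩; exact hxK i)
  obtain ⟨γ, hγ⟩ := Field.exists_primitive_element K L
  have hγx : ∀ i, ∃ p : K[X], aeval (γ : F) p = x i := by
    intro i
    have h1 : (⟨x i, IntermediateField.subset_adjoin _ _ ⟨i, rfl⟩⟩ : L) ∈
        (IntermediateField.adjoin K {γ}).toSubalgebra := by
      rw [hγ]; trivial
    rw [IntermediateField.adjoin_simple_toSubalgebra_of_isAlgebraic (IsAlgebraic.of_finite K γ),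
      Algebra.adjoin_singleton_eq_range_aeval] at h1
    obtain ⟨p, hp⟩ := h1
    refine ⟨p, ?_⟩
    have := congrArg (algebraMap L F) hp
    rwa [AlgHom.toRingHom_eq_coe, RingHom.coe_coe, ← aeval_algebraMap_apply] at this
  have hγa : IsAlgebraic A (γ : F) := (IsFractionRing.isAlgebraic_iff A K F).2
    ((IsAlgebraic.of_finite K γ).algebraMap)
  obtain ⟨a, ha, hintegral⟩ := hγa.exists_integral_multiple
  have haF : algebraMap A F a ≠ 0 := by
    simpa using ha
  have haK : algebraMap A K a ≠ 0 := by simpa using ha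
  set α : F := a • (γ : F) with hα
  have hαx : ∀ i, ∃ (b : A) (p : A[X]), b ≠ 0 ∧ aeval α p = algebraMap A F b * x i := by
    intro i
    obtain ⟨p, hp⟩ := hγx i
    obtain ⟨b, hb0, hb⟩ := IsLocalization.integerNormalization_spec (nonZeroDivisors A)
      (p.comp (C (algebraMap A K a)⁻¹ * X))
    refine ⟨b, IsLocalization.integerNormalization (nonZeroDivisors A)
      (p.comp (C (algebraMap A K a)⁻¹ * X)), nonZeroDivisors.ne_zero hb0, ?_⟩
    have hαγ : aeval α (C (algebraMap A K a)⁻¹ * X) = (γ : F) := by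
      rw [map_mul, aeval_C, aeval_X, hα, Algebra.smul_def, map_inv₀,
        ← IsScalarTower.algebraMap_apply A K F, inv_mul_cancel_left₀ haF]
    rw [← aeval_map_algebraMap K α, hb, ← algebraMap_smul K b, map_smul, Algebra.smul_def,
      aeval_comp, hαγ, hp, ← IsScalarTower.algebraMap_apply A K F]
  choose b P hb hP using hαx
  have := Fintype.ofFinite σ
  refine ⟨α, minpoly A α, ∏ i, b i, fun i => C (∏ j ∈ Finset.univ.erase i, b j) * P i,
    Finset.prod_ne_zero_iff.2 fun i _ => hb i, minpoly.monic hintegral, minpoly.aeval _ _, ?_,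
    fun G hG => minpoly.isIntegrallyClosed_dvd hintegral hG, fun i => ?_⟩
  · have h1 : (minpoly K α).Separable := (minpoly.irreducible hintegral.tower_top).separable
    rw [minpoly.isIntegrallyClosed_eq_field_fractions' K hintegral] at h1
    have h2 := h1.map (f := algebraMap K F)
    rwa [Polynomial.map_map, ← IsScalarTower.algebraMap_eq] at h2
  · rw [map_mul, aeval_C, hP, ← mul_assoc, ← map_mul, mul_comm (Finset.prod _ _),
      Finset.mul_prod_erase _ _ (Finset.mem_univ i)]

end Presentation

theorem exists_clear_denominators {R B σ : Type*} [CommRing R] [CommRing B] [Algebra R B]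
    (F : Type*) [Field F] [Algebra R F] (P : σ → B) (b : B) (h : MvPolynomial σ R) :
    ∃ (N : ℕ) (H : B), ∀ φ : B →ₐ[R] F, φ b ≠ 0 →
      φ H = φ b ^ N * MvPolynomial.aeval (fun i => φ (P i) / φ b) h := by
  induction h using MvPolynomial.induction_on with
  | C a => exact ⟨0, algebraMap R B a, fun φ _ => by simp⟩
  | add p q hp hq =>
    obtain ⟨N, H, hH⟩ := hp
    obtain ⟨N', H', hH'⟩ := hq
    refine ⟨N + N', b ^ N' * H + b ^ N * H', fun φ hφ => ?_⟩
    rw [map_add, map_mul, map_mul, hH φ hφ, hH' φ hφ]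
    simp only [map_pow, map_add]
    ring
  | mul_X p i hp =>
    obtain ⟨N, H, hH⟩ := hp
    refine ⟨N + 1, H * P i, fun φ hφ => ?_⟩
    rw [map_mul, hH φ hφ]
    simp only [map_mul, MvPolynomial.aeval_X]
    rw [pow_succ]
    field_simp

theorem _root_.IsAlgebraic.of_forall_mem_range {K K' F : Type*} [Field K] [Field K'] [Field F]
    [Algebra K F] [Algebra K' F] (h : ∀ e, algebraMap K' F e ∈ Set.range (algebraMap K F)) {x : F}
    (hx : IsAlgebraic K' x) : IsAlgebraic K x := by
  obtain ⟨p, hp0, hp⟩ := hx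
  obtain ⟨q, hq⟩ : p.map (algebraMap K' F) ∈ lifts (algebraMap K F) :=
    (lifts_iff_coeff_lifts _).2 fun n => by rw [coeff_map]; exact h _
  rw [coe_mapRingHom] at hq
  refine ⟨q, ?_, ?_⟩
  · rintro rfl
    exact hp0 ((Polynomial.map_eq_zero _).1 (by rw [← hq, Polynomial.map_zero]))
  · rw [← eval_map_algebraMap, hq, eval_map_algebraMap, hp]

section Descent

variable {F Ω : Type*} [Field F] [LinearOrder F] [IsStrictOrderedRing F] [Field Ω] [IsAlgClosed Ω]
  [Algebra F Ω] {I : Ω}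

open Matrix in
/-- A generic diagonalisation of the Hermite matrix of `m`. -/
theorem exists_generic_hermite {A : Type*} (F Ω : Type*) [CommRing A] [IsDomain A] [CharZero A]
    [Field F] [Field Ω] [Algebra F Ω] (m : A[X]) :
    ∃ (H P : Matrix (Fin m.natDegree) (Fin m.natDegree) A) (d : Fin m.natDegree → A),
      P.det ≠ 0 ∧ ∀ φ : A →+* F, IsHermiteMatrix Ω (m.map φ) (H.map φ) ∧
        (P.map φ)ᵀ * H.map φ * P.map φ = Matrix.diagonal (fun i => φ (d i)) := by
  choose S hS using exists_powerSum (Ω := Ω) m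
  obtain ⟨P, d, hP, hd⟩ := exists_diagonal_congruence
    (Matrix.of fun i j : Fin m.natDegree => S (i.1 + j.1))
    (by ext i j; simp [add_comm])
  refine ⟨Matrix.of fun i j => S (i.1 + j.1), P, d, hP, fun φ => ⟨fun s hs hms i j => ?_, ?_⟩⟩
  · exact hS _ ((algebraMap F Ω).comp φ) s hs (by rw [← hms, Polynomial.map_map])
  · rw [← Matrix.transpose_map, ← Matrix.map_mul, ← Matrix.map_mul, hd,
      Matrix.diagonal_map (map_zero φ)]

/-- A transcendental element of an ordered field can be replaced by an element of the base field
without changing the signs of the values of a nonzero polynomial's divisors. -/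
theorem exists_same_sign (hI : I ^ 2 = -1)
    (hspan : ∀ z : Ω, ∃ a b : F, z = algebraMap F Ω a + algebraMap F Ω b * I)
    {R : Type*} [Field R] [Algebra R F]
    (hR : ∀ a : F, IsAlgebraic R a → a ∈ Set.range (algebraMap R F)) {t : F}
    (ht : t ∉ Set.range (algebraMap R F)) {p : R[X]} (hp : p ≠ 0) :
    ∃ τ : R, ∀ q : R[X], q ∣ p → 0 < aeval t q * aeval (algebraMap R F τ) q := by
  classical
  let _ : LinearOrder R := LinearOrder.lift' (algebraMap R F) (algebraMap R F).injective
  have hlt : ∀ a b : R, a < b ↔ algebraMap R F a < algebraMap R F b := fun _ _ => Iff.rfl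
  have _ : IsStrictOrderedRing R := Function.Injective.isStrictOrderedRing (algebraMap R F)
    (map_zero _) (map_one _) (map_add _) (map_mul _) Iff.rfl Iff.rfl
  let Z := p.roots.toFinset
  obtain ⟨τ, hτ1, hτ2⟩ := Order.exists_between_finsets
    (Z.filter fun z => algebraMap R F z < t) (Z.filter fun z => t < algebraMap R F z)
    (fun x hx y hy => (hlt x y).2
      ((Finset.mem_filter.1 hx).2.trans (Finset.mem_filter.1 hy).2))
  refine ⟨τ, fun q hq => ?_⟩
  have hq0 : q ≠ 0 := ne_zero_of_dvd_ne_zero hp hq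
  rw [← eval_map_algebraMap, ← eval_map_algebraMap]
  refine eval_mul_eval_pos_of_no_root hI hspan _ fun c hc h0 => ?_
  rw [eval_map_algebraMap] at h0
  obtain ⟨z, rfl⟩ := hR c ⟨q, hq0, h0⟩
  rw [aeval_algebraMap_apply, map_eq_zero_iff _ (algebraMap R F).injective, coe_aeval_eq_eval]
    at h0
  have hz : z ∈ Z := by
    rw [Multiset.mem_toFinset, mem_roots hp]
    exact IsRoot.dvd h0 hq
  rcases lt_trichotomy (algebraMap R F z) t with h | h | h
  · have h' := (hlt _ _).1 (hτ1 z (Finset.mem_filter.2 ⟨hz, h⟩))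
    rcases Set.mem_uIcc.1 hc with h1 | h1 <;> linarith [h1.1, h1.2]
  · exact ht ⟨z, h⟩
  · have h' := (hlt _ _).1 (hτ2 z (Finset.mem_filter.2 ⟨hz, h⟩))
    rcases Set.mem_uIcc.1 hc with h1 | h1 <;> linarith [h1.1, h1.2]

/-- Polynomial equations which are solvable over `R(t)ᵃˡᵍ ∩ F` are solvable over `R`, if `R` is
algebraically closed in the real closed field `F`. -/
theorem exists_aeval_eq_zero_of_isAlgebraic_adjoin (hI : I ^ 2 = -1)
    (hspan : ∀ z : Ω, ∃ a b : F, z = algebraMap F Ω a + algebraMap F Ω b * I)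
    {R : Type*} [Field R] [Algebra R F]
    (hR : ∀ a : F, IsAlgebraic R a → a ∈ Set.range (algebraMap R F)) (t : F)
    {σ : Type*} [Finite σ] (x : σ → F)
    (hx : ∀ i, IsAlgebraic (IntermediateField.adjoin R {t}) (x i))
    (J : Set (MvPolynomial σ R)) (hJ : ∀ h ∈ J, MvPolynomial.aeval x h = 0) :
    ∃ y : σ → R, ∀ h ∈ J, MvPolynomial.aeval y h = 0 := by
  classical
  have hinj := (algebraMap R F).injective
  suffices h : ∃ y : σ → R, ∀ h ∈ J, MvPolynomial.aeval (fun i => algebraMap R F (y i)) h = 0 by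
    obtain ⟨y, hy⟩ := h
    refine ⟨y, fun h hh => hinj ?_⟩
    rw [map_zero, ← hy h hh, ← MvPolynomial.aeval_algebraMap_apply]
    rfl
  by_cases ht : t ∈ Set.range (algebraMap R F)
  · have hx' : ∀ i, x i ∈ Set.range (algebraMap R F) := fun i => hR _ <| by
      refine (hx i).of_forall_mem_range fun e => ?_
      have h1 : IntermediateField.adjoin R {t} = ⊥ :=
        IntermediateField.adjoin_simple_eq_bot_iff.2 (IntermediateField.mem_bot.2 ht)
      exact IntermediateField.mem_bot.1 (h1 ▸ e.2)
    choose y hy using hx'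
    exact ⟨y, by simpa only [hy] using hJ⟩
  let _ : Algebra R[X] F := (aeval (R := R) t).toRingHom.toAlgebra
  have hmap : ∀ p : R[X], algebraMap R[X] F p = aeval t p := fun _ => rfl
  have _ : IsScalarTower R R[X] F := IsScalarTower.of_algebraMap_eq fun a => by
    rw [hmap, ← Polynomial.C_eq_algebraMap, aeval_C]
  have htr : Function.Injective (algebraMap R[X] F) := by
    rw [injective_iff_map_eq_zero]
    intro p hp
    by_contra hp0
    exact ht (hR t ⟨p, hp0, hp⟩)
  have _ : FaithfulSMul R[X] F := (faithfulSMul_iff_algebraMap_injective _ _).2 htr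
  have _ : CharZero R := (algebraMap R F).charZero
  have hxA : ∀ i, IsAlgebraic R[X] (x i) := fun i => by
    let _ : Algebra (FractionRing R[X]) F := FractionRing.liftAlgebra R[X] F
    have _ : IsScalarTower R[X] (FractionRing R[X]) F := FractionRing.isScalarTower_liftAlgebra _ _
    refine (IsFractionRing.isAlgebraic_iff R[X] (FractionRing R[X]) F).2
      ((hx i).of_forall_mem_range fun e => ?_)
    have h1 : IntermediateField.adjoin R {t} ≤
        (IsScalarTower.toAlgHom R (FractionRing R[X]) F).fieldRange := by
      rw [IntermediateField.adjoin_simple_le_iff]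
      refine ⟨algebraMap R[X] _ X, ?_⟩
      change algebraMap (FractionRing R[X]) F _ = t
      rw [← IsScalarTower.algebraMap_apply, hmap, aeval_X]
    exact h1 e.2
  obtain ⟨α, m, b, P, hb, hm, hmα, hsep, hdvd, hP⟩ := exists_primitive_presentation x hxA
  obtain ⟨H, Q, d, hQ, hHQ⟩ := exists_generic_hermite F Ω m
  let p : R[X] := b * Q.det * ∏ i, if d i = 0 then 1 else d i
  have hp : p ≠ 0 := by
    refine mul_ne_zero (mul_ne_zero hb hQ) (Finset.prod_ne_zero_iff.2 fun i _ => ?_)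
    split_ifs with h
    · exact one_ne_zero
    · exact h
  obtain ⟨τ, hτ⟩ := exists_same_sign hI hspan hR ht hp
  have hsign : ∀ i, 0 < aeval t (d i) → 0 < aeval (algebraMap R F τ) (d i) := fun i hi => by
    have hdi : d i ≠ 0 := by rintro h; simp [h] at hi
    refine (pos_iff_pos_of_mul_pos (hτ (d i) ?_)).1 hi
    refine Dvd.dvd.mul_left ?_ _
    simpa [hdi] using Finset.dvd_prod_of_mem (fun i => if d i = 0 then 1 else d i)
      (Finset.mem_univ i)
  have hbτ : aeval (algebraMap R F τ) b ≠ 0 := fun h => by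
    have := hτ b (Dvd.intro _ (mul_assoc _ _ _).symm)
    simp [h] at this
  obtain ⟨β, hβ⟩ : ∃ β, (m.map (aeval (algebraMap R F τ)).toRingHom).IsRoot β := by
    by_contra! hno
    obtain ⟨hH1, hd1⟩ := hHQ (aeval (algebraMap R F τ)).toRingHom
    obtain ⟨hH2, hd2⟩ := hHQ (algebraMap R[X] F)
    have h1 := two_mul_card_pos_le_of_no_root hI hspan (hm.map _) (hm.natDegree_map _) hH1 hd1 hno
    have h2 := two_mul_card_nonpos_lt_of_root hI hspan (hm.map _) (hm.natDegree_map _) hH2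
      (P := Q.map (algebraMap R[X] F)) (by
        have := (RingHom.map_det (algebraMap R[X] F) Q).symm
        rw [RingHom.mapMatrix_apply] at this
        rw [this]
        exact (map_ne_zero_iff _ htr).2 hQ) hd2 hsep (r := α)
      (by rw [IsRoot, eval_map_algebraMap, hmα])
    have h3 : (Finset.univ.filter fun i => 0 < algebraMap R[X] F (d i)).card ≤
        (Finset.univ.filter fun i => 0 < (aeval (algebraMap R F τ)).toRingHom (d i)).card :=
      Finset.card_le_card (Finset.monotone_filter_right _ fun i _ => hsign i)
    have h4 := Finset.card_filter_add_card_filter_not (s := Finset.univ)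
      fun i => 0 < algebraMap R[X] F (d i)
    simp only [not_lt, Finset.card_univ, Fintype.card_fin] at h4
    omega
  have hroot : ∀ h ∈ J, MvPolynomial.aeval (fun i =>
      aevalTower (aeval (R := R) (algebraMap R F τ)) β (P i) / aeval (algebraMap R F τ) b) h = 0 :=
    by
    intro h hh
    obtain ⟨N, G, hG⟩ := exists_clear_denominators F P (C b) h
    have h1 := hG (aevalTower (aeval (R := R) t) α)
    have h2 := hG (aevalTower (aeval (R := R) (algebraMap R F τ)) β)
    rw [aevalTower_C] at h1 h2
    have hbt : aeval t b ≠ 0 := (map_ne_zero_iff (algebraMap R[X] F) htr).2 hb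
    have hPx : ∀ i, aevalTower (aeval (R := R) t) α (P i) / aeval t b = x i := fun i =>
      (div_eq_iff hbt).2 ((hP i).trans (mul_comm _ _))
    simp only [hPx, hJ h hh, mul_zero] at h1
    obtain ⟨G', rfl⟩ := hdvd G (h1 hbt)
    have h3 : aevalTower (aeval (R := R) (algebraMap R F τ)) β m = 0 := by
      rw [IsRoot, eval_map] at hβ
      exact hβ
    have h4 := h2 hbτ
    rw [map_mul, h3, zero_mul] at h4
    exact (mul_eq_zero.1 h4.symm).resolve_left (pow_ne_zero _ hbτ)
  have hval : ∀ i, aevalTower (aeval (R := R) (algebraMap R F τ)) β (P i) /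
      aeval (algebraMap R F τ) b ∈ Set.range (algebraMap R F) := by
    obtain ⟨β', rfl⟩ := hR β ⟨m.map (evalRingHom τ), (hm.map _).ne_zero, by
      rw [← hβ.eq_zero, aeval_def, eval₂_map, eval_map]
      congr 1
      ext a <;> simp⟩
    refine fun i => ⟨aevalTower (aeval (R := R) τ) β' (P i) / aeval τ b, ?_⟩
    rw [map_div₀, aeval_algebraMap_apply]
    congr 1
    change Algebra.ofId R F _ = _
    rw [← AlgHom.comp_apply]
    congr 1
    ext <;> simp [Algebra.ofId_apply]
  choose y hy using hval
  exact ⟨y, by simpa only [hy] using hroot⟩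

end Descent

section RealClosure

/-- `F` is a real field none of whose proper algebraic extensions inside `Ω` is real. -/
def IsMaximalReal (F Ω : Type*) [Field F] [Field Ω] [Algebra F Ω] : Prop :=
  ¬ IsSumSq (-1 : F) ∧ ∀ α : Ω, α ∉ Set.range (algebraMap F Ω) →
    ∃ l : List F[X], (∀ p ∈ l, p.degree < (minpoly F α).degree) ∧
      aeval α (1 + (l.map (· ^ 2)).sum) = 0

variable {F Ω : Type*} [Field F] [Field Ω] [Algebra F Ω]

theorem IsMaximalReal.isSquare_or_isSumSq_neg [IsAlgClosed Ω] (h : IsMaximalReal F Ω) (a : F) :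
    IsSquare a ∨ IsSumSq (-a) := by
  obtain ⟨α, hα⟩ := IsAlgClosed.exists_pow_nat_eq (algebraMap F Ω a) two_pos
  by_cases hαF : α ∈ Set.range (algebraMap F Ω)
  · obtain ⟨b, rfl⟩ := hαF
    exact Or.inl ⟨b, (algebraMap F Ω).injective (by rw [← hα, map_mul, sq])⟩
  obtain ⟨l, hl, hl0⟩ := h.2 α hαF
  have hdeg : (minpoly F α).degree ≤ 2 := by
    refine (minpoly.min F α (monic_X_pow_sub_C a two_ne_zero) (by simp [hα])).trans ?_
    rw [degree_X_pow_sub_C two_pos]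
    rfl
  have key : ∀ l : List F[X], (∀ p ∈ l, p.degree < (minpoly F α).degree) →
      ∃ A B c : F, IsSumSq A ∧ IsSumSq B ∧ aeval α (l.map (· ^ 2)).sum =
        algebraMap F Ω (A + a * B) + algebraMap F Ω c * α := by
    intro l
    induction l with
    | nil => exact fun _ => ⟨0, 0, 0, IsSumSq.zero, IsSumSq.zero, by simp⟩
    | cons p l ih =>
      intro hp
      obtain ⟨A, B, c, hA, hB, hs⟩ := ih fun q hq => hp q (List.mem_cons_of_mem _ hq)
      have hp1 : p.degree < 2 := (hp p List.mem_cons_self).trans_le hdeg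
      obtain ⟨v, u, rfl⟩ := exists_eq_X_add_C_of_natDegree_le_one
        (natDegree_le_of_degree_le (Order.le_of_lt_succ hp1))
      refine ⟨u * u + A, v * v + B, 2 * u * v + c, hA.sq_add u, hB.sq_add v, ?_⟩
      rw [List.map_cons, List.sum_cons, map_add, hs]
      simp only [map_add, map_mul, map_pow, aeval_C, aeval_X, map_ofNat]
      linear_combination (algebraMap F Ω v) ^ 2 * hα
  obtain ⟨A, B, c, hA, hB, hs⟩ := key l hl
  rw [map_add, map_one, hs] at hl0
  have hc : c = 0 := by
    by_contra hc
    refine hαF ⟨-(1 + (A + a * B)) / c, ?_⟩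
    rw [map_div₀, div_eq_iff ((_root_.map_ne_zero _).2 hc)]
    simp only [map_neg, map_add, map_one, map_mul] at hl0 ⊢
    linear_combination -hl0
  have h1 : 1 + A + a * B = 0 := (algebraMap F Ω).injective (by
    rw [hc] at hl0
    simp only [map_add, map_one, map_mul, map_zero] at hl0 ⊢
    linear_combination hl0)
  have hB0 : B ≠ 0 := by
    rintro rfl
    exact h.1 (by rwa [show (-1 : F) = A by linear_combination -h1])
  right
  have h2 : -a = ((1 * 1 + A) * B) * (B⁻¹ * B⁻¹) := by
    field_simp
    linear_combination -h1
  rw [h2]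
  exact ((hA.sq_add 1).mul hB).mul (IsSumSq.mul_self _)

theorem IsMaximalReal.isSquare_of_isSumSq [IsAlgClosed Ω] (h : IsMaximalReal F Ω) {a : F}
    (ha : IsSumSq a) : IsSquare a := by
  rcases h.isSquare_or_isSumSq_neg a with h1 | h1
  · exact h1
  by_cases ha0 : a = 0
  · exact ha0 ▸ IsSquare.zero
  refine absurd ?_ h.1
  have h2 : (-1 : F) = (-a * a) * (a⁻¹ * a⁻¹) := by field_simp
  rw [h2]
  exact (h1.mul ha).mul (IsSumSq.mul_self _)

/-- The order of a maximal real field: the nonnegative elements are the squares. -/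
theorem IsMaximalReal.exists_order [IsAlgClosed Ω] (h : IsMaximalReal F Ω) :
    ∃ (_ : LinearOrder F), IsStrictOrderedRing F ∧ ∀ a : F, 0 ≤ a → IsSquare a := by
  classical
  have hadd : ∀ {a b : F}, IsSquare a → IsSquare b → IsSquare (a + b) := fun ha hb =>
    h.isSquare_of_isSumSq (ha.isSumSq.add hb.isSumSq)
  have hanti : ∀ {a : F}, IsSquare a → IsSquare (-a) → a = 0 := fun {a} ha hb => by
    by_contra ha0
    refine h.1 ?_
    have h2 : (-1 : F) = (-a * a) * (a⁻¹ * a⁻¹) := by field_simp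
    rw [h2]
    exact (hb.isSumSq.mul ha.isSumSq).mul (IsSumSq.mul_self _)
  let inst : LinearOrder F :=
    { le := fun a b => IsSquare (b - a)
      le_refl := fun a => by simp
      le_trans := fun a b c hab hbc => by
        have := hadd hab hbc
        rwa [show b - a + (c - b) = c - a by ring] at this
      le_antisymm := fun a b hab hba => by
        refine (sub_eq_zero.1 (hanti hab ?_)).symm
        rwa [neg_sub]
      le_total := fun a b => by
        rcases h.isSquare_or_isSumSq_neg (b - a) with h1 | h1
        · exact Or.inl h1
        · right
          rw [neg_sub] at h1
          exact h.isSquare_of_isSumSq h1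
      toDecidableLE := Classical.decRel _ }
  have hle : ∀ a b : F, a ≤ b ↔ IsSquare (b - a) := fun _ _ => Iff.rfl
  refine ⟨inst, ?_, fun a ha => by rwa [hle, sub_zero] at ha⟩
  have h1 : IsOrderedAddMonoid F :=
    { add_le_add_left := fun a b hab c => by
        rw [hle] at hab ⊢
        rwa [add_sub_add_right_eq_sub] }
  have h2 : ZeroLEOneClass F := ⟨by rw [hle, sub_zero]; exact IsSquare.one⟩
  refine IsStrictOrderedRing.of_mul_pos fun a b ha hb => ?_
  have ha' := (hle _ _).1 ha.le
  have hb' := (hle _ _).1 hb.le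
  rw [sub_zero] at ha' hb'
  refine lt_of_le_of_ne ((hle _ _).2 ?_) (mul_ne_zero ha.ne' hb.ne').symm
  rw [sub_zero]
  exact ha'.mul hb'

theorem even_natDegree_and_leadingCoeff_pos_of_add [LinearOrder F] [IsStrictOrderedRing F]
    {f g : F[X]} (hf : Even f.natDegree ∧ 0 < f.leadingCoeff)
    (hg : Even g.natDegree ∧ 0 < g.leadingCoeff) :
    Even (f + g).natDegree ∧ 0 < (f + g).leadingCoeff := by
  rcases lt_trichotomy f.natDegree g.natDegree with h | h | h
  · rw [natDegree_add_eq_right_of_natDegree_lt h,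
      leadingCoeff_add_of_degree_lt (degree_lt_degree h)]
    exact hg
  · have hpos : 0 < f.leadingCoeff + g.leadingCoeff := add_pos hf.2 hg.2
    have hf0 : f ≠ 0 := leadingCoeff_ne_zero.1 hf.2.ne'
    have hg0 : g ≠ 0 := leadingCoeff_ne_zero.1 hg.2.ne'
    have hd : f.degree = g.degree := by
      rw [degree_eq_natDegree hf0, degree_eq_natDegree hg0, h]
    have hc : (f + g).coeff g.natDegree ≠ 0 := by
      rw [coeff_add]
      nth_rw 1 [← h]
      exact hpos.ne'
    have hn : (f + g).natDegree = g.natDegree :=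
      natDegree_eq_of_le_of_coeff_ne_zero ((natDegree_add_le _ _).trans (by simp [h])) hc
    rw [leadingCoeff_add_of_degree_eq hd hpos.ne', hn]
    exact ⟨hg.1, hpos⟩
  · rw [natDegree_add_eq_left_of_natDegree_lt h, add_comm,
      leadingCoeff_add_of_degree_lt (degree_lt_degree h)]
    exact hf

theorem IsMaximalReal.exists_isRoot_of_odd_natDegree [IsAlgClosed Ω] [Algebra.IsAlgebraic F Ω]
    (h : IsMaximalReal F Ω) (p : F[X]) (hp : Odd p.natDegree) : ∃ r, p.IsRoot r := by
  obtain ⟨_, _, -⟩ := h.exists_order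
  induction hn : p.natDegree using Nat.strong_induction_on generalizing p with
  | _ n ih =>
  have hp0 : p ≠ 0 := by rintro rfl; simp at hp
  have hpu : ¬ IsUnit p := fun hu => by
    rw [natDegree_eq_zero_of_isUnit hu] at hp; simp at hp
  by_cases hirr : Irreducible p
  · obtain ⟨α, hα⟩ := IsAlgClosed.exists_aeval_eq_zero Ω p hirr.degree_pos.ne'
    by_cases hαF : α ∈ Set.range (algebraMap F Ω)
    · obtain ⟨r, rfl⟩ := hαF
      refine ⟨r, (algebraMap F Ω).injective ?_⟩
      rw [map_zero, ← hα, aeval_algebraMap_apply, coe_aeval_eq_eval]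
    obtain ⟨l, hl, hl0⟩ := h.2 α hαF
    have hmn : (minpoly F α).natDegree = n := by
      rw [← minpoly.eq_of_irreducible hirr hα, natDegree_mul_leadingCoeff_inv _ hp0, hn]
    have key : ∀ l : List F[X], (∀ q ∈ l, q.degree < (minpoly F α).degree) →
        (Even (1 + (l.map (· ^ 2)).sum).natDegree ∧ 0 < (1 + (l.map (· ^ 2)).sum).leadingCoeff) ∧
          (1 + (l.map (· ^ 2)).sum).natDegree ≤ 2 * (n - 1) := by
      intro l
      induction l with
      | nil => simp
      | cons q l ihl =>
        intro hq
        obtain ⟨h1, h2⟩ := ihl fun q' hq' => hq q' (List.mem_cons_of_mem _ hq')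
        rw [List.map_cons, List.sum_cons, add_left_comm]
        by_cases hq0 : q = 0
        · simpa [hq0] using ⟨h1, h2⟩
        have h3 := natDegree_lt_natDegree hq0 (hq q List.mem_cons_self)
        have h5 : q.leadingCoeff ≠ 0 := leadingCoeff_ne_zero.2 hq0
        have h4 : (q ^ 2).natDegree = 2 * q.natDegree := natDegree_pow q 2
        refine ⟨even_natDegree_and_leadingCoeff_pos_of_add ⟨by simp [h4], ?_⟩ h1,
          (natDegree_add_le _ _).trans (max_le (by omega) h2)⟩
        rw [leadingCoeff_pow]
        positivity
    obtain ⟨⟨heven, hlc⟩, hle⟩ := key l hl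
    obtain ⟨k, hk⟩ := minpoly.dvd F α hl0
    have hG0 : (1 + (l.map (· ^ 2)).sum) ≠ 0 := leadingCoeff_ne_zero.1 hlc.ne'
    have hk0 : k ≠ 0 := by rintro rfl; exact hG0 (by rw [hk, mul_zero])
    have hdeg := congrArg natDegree hk
    rw [natDegree_mul (minpoly.ne_zero (Algebra.IsAlgebraic.isAlgebraic α).isIntegral) hk0, hmn]
      at hdeg
    have hnpos : 0 < n := hn ▸ hp.pos
    obtain ⟨r, hr⟩ := ih k.natDegree (by omega) k (by
      rw [hdeg] at heven
      rw [hn] at hp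
      exact (Nat.even_add'.1 heven).1 hp) rfl
    have h5 := congrArg (eval r) hk
    rw [eval_mul, hr.eq_zero, mul_zero, eval_add, eval_one, ← coe_evalRingHom,
      map_list_sum, List.map_map] at h5
    have h6 : 0 ≤ (l.map (evalRingHom r ∘ fun x => x ^ 2)).sum := List.sum_nonneg fun x hx => by
      obtain ⟨q, -, rfl⟩ := List.mem_map.1 hx
      simp only [Function.comp_apply, coe_evalRingHom, eval_pow]
      positivity
    linarith
  · obtain ⟨a, b, rfl, ha, hb⟩ : ∃ a b, p = a * b ∧ ¬ IsUnit a ∧ ¬ IsUnit b := by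
      rw [irreducible_iff] at hirr
      push Not at hirr
      obtain ⟨a, b, h1, h2, h3⟩ := hirr hpu
      exact ⟨a, b, h1, h2, h3⟩
    have ha0 := left_ne_zero_of_mul hp0
    have hb0 := right_ne_zero_of_mul hp0
    have hap := natDegree_pos_iff_degree_pos.2 (degree_pos_of_ne_zero_of_nonunit ha0 ha)
    have hbp := natDegree_pos_iff_degree_pos.2 (degree_pos_of_ne_zero_of_nonunit hb0 hb)
    rw [natDegree_mul ha0 hb0] at hn hp
    rcases Nat.even_or_odd b.natDegree with hbe | hbo
    · obtain ⟨r, hr⟩ := ih a.natDegree (by omega) a ((Nat.odd_add.1 hp).2 hbe) rfl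
      exact ⟨r, IsRoot.dvd hr (dvd_mul_right _ _)⟩
    · obtain ⟨r, hr⟩ := ih b.natDegree (by omega) b hbo rfl
      exact ⟨r, IsRoot.dvd hr (dvd_mul_left _ _)⟩

theorem _root_.isSumSq_map {R S : Type*} [CommRing R] [CommRing S] (f : R →+* S) {a : R}
    (ha : IsSumSq a) : IsSumSq (f a) := by
  induction ha with
  | zero => rw [map_zero]; exact IsSumSq.zero
  | sq_add a _ ih => rw [map_add, map_mul]; exact ih.sq_add _

/-- Every real field has a maximal real algebraic extension. -/
theorem exists_isMaximalReal (K Ω : Type*) [Field K] [Field Ω] [Algebra K Ω]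
    [Algebra.IsAlgebraic K Ω] (hK : ¬ IsSumSq (-1 : K)) :
    ∃ F : IntermediateField K Ω, IsMaximalReal F Ω := by
  have hbot : ¬ IsSumSq (-1 : (⊥ : IntermediateField K Ω)) := fun h => hK (by
    simpa using isSumSq_map (IntermediateField.botEquiv K Ω).toRingEquiv.toRingHom h)
  obtain ⟨F, -, hF⟩ := zorn_le_nonempty₀ {F : IntermediateField K Ω | ¬ IsSumSq (-1 : F)} (by
    intro c hc hchain y hy
    have hmem : ∀ a : Ω, a ∈ sSup c ↔ ∃ F ∈ c, a ∈ F := fun a => by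
      have : Nonempty c := ⟨⟨y, hy⟩⟩
      rw [sSup_eq_iSup', ← SetLike.mem_coe,
        IntermediateField.coe_iSup_of_directed hchain.directed]
      simp
    refine ⟨sSup c, fun hsum => ?_, fun z hz => le_sSup hz⟩
    have key : ∀ s : ↥(sSup c), IsSumSq s → ∃ F ∈ c, ∃ s' : F, (s' : Ω) = s ∧ IsSumSq s' := by
      intro s hs
      induction hs with
      | zero => exact ⟨y, hy, 0, rfl, IsSumSq.zero⟩
      | sq_add a _ ih =>
        obtain ⟨F, hF, s', hs', hs''⟩ := ih
        obtain ⟨F', hF', ha⟩ := (hmem a).1 a.2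
        obtain ⟨F'', hF'', h1, h2⟩ := hchain.directedOn F hF F' hF'
        refine ⟨F'', hF'', ⟨a, h2 ha⟩ * ⟨a, h2 ha⟩ + IntermediateField.inclusion h1 s', ?_,
          (isSumSq_map (IntermediateField.inclusion h1).toRingHom hs'').sq_add _⟩
        simp [hs']
    obtain ⟨F, hF, s', hs', hs''⟩ := key _ hsum
    refine hc hF ?_
    rwa [show s' = -1 from Subtype.ext (by simpa using hs')] at hs'') ⊥ hbot
  refine ⟨F, hF.prop, fun α hα => ?_⟩
  have hintegral : IsIntegral F α := Algebra.IsIntegral.isIntegral α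
  have hsum : IsSumSq (-1 : IntermediateField.adjoin F {α}) := by
    by_contra hsum
    have h1 : F ≤ (IntermediateField.adjoin F {α}).restrictScalars K := fun a ha =>
      (IntermediateField.adjoin F {α}).algebraMap_mem ⟨a, ha⟩
    have h2 := hF.le_of_ge (y := (IntermediateField.adjoin F {α}).restrictScalars K) hsum h1
    exact hα ⟨⟨α, h2 (IntermediateField.mem_adjoin_simple_self F α)⟩, rfl⟩
  have key : ∀ s : IntermediateField.adjoin F {α}, IsSumSq s → ∃ l : List (Polynomial F),
      (∀ p ∈ l, p.degree < (minpoly F α).degree) ∧ aeval α (l.map (· ^ 2)).sum = (s : Ω) := by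
    intro s hs
    induction hs with
    | zero => exact ⟨[], by simp, by simp⟩
    | sq_add a _ ih =>
      obtain ⟨l, hl, hs⟩ := ih
      have ha : (a : Ω) ∈ (IntermediateField.adjoin F {α}).toSubalgebra := a.2
      rw [IntermediateField.adjoin_simple_toSubalgebra_of_isAlgebraic hintegral.isAlgebraic,
        Algebra.adjoin_singleton_eq_range_aeval] at ha
      obtain ⟨p, hp⟩ := ha
      have hp' : aeval α p = (a : Ω) := hp
      refine ⟨p %ₘ minpoly F α :: l, ?_, ?_⟩
      · rintro q hq
        rcases List.mem_cons.1 hq with rfl | hq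
        · exact degree_modByMonic_lt _ (minpoly.monic hintegral)
        · exact hl q hq
      · rw [List.map_cons, List.sum_cons, map_add, hs, map_pow,
          aeval_modByMonic_eq_self_of_root (minpoly.aeval F α), hp']
        push_cast
        ring
  obtain ⟨l, hl, hs⟩ := key _ hsum
  exact ⟨l, hl, by rw [map_add, hs]; simp⟩

theorem finrank_eq_one_of_forall_exists_isRoot {F L : Type*} [Field F] [Field L] [Algebra F L]
    [FiniteDimensional F L] [Algebra.IsSeparable F L]
    (h : ∀ p : F[X], p.Monic → p.natDegree = Module.finrank F L → ∃ r, p.IsRoot r) :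
    Module.finrank F L = 1 := by
  obtain ⟨α, hα⟩ := Field.exists_primitive_element F L
  have hintegral : IsIntegral F α := Algebra.IsIntegral.isIntegral α
  have hdeg : (minpoly F α).natDegree = Module.finrank F L := by
    rw [← IntermediateField.adjoin.finrank hintegral, hα, IntermediateField.finrank_top']
  obtain ⟨r, hr⟩ := h _ (minpoly.monic hintegral) hdeg
  rw [← hdeg]
  exact natDegree_eq_of_degree_eq_some
    (degree_eq_one_of_irreducible_of_root (minpoly.irreducible hintegral) hr)

theorem exists_finrank_eq_two_pow {F N : Type*} [Field F] [Field N] [Algebra F N]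
    [FiniteDimensional F N] [IsGalois F N]
    (h : ∀ p : F[X], Odd p.natDegree → ∃ r, p.IsRoot r) : ∃ k, Module.finrank F N = 2 ^ k := by
  obtain ⟨P⟩ : Nonempty (Sylow 2 Gal(N/F)) := inferInstance
  let L := IntermediateField.fixedField (P : Subgroup Gal(N/F))
  have h1 : Module.finrank F L = (P : Subgroup Gal(N/F)).index := by
    rw [IntermediateField.finrank_eq_fixingSubgroup_index,
      IntermediateField.fixingSubgroup_fixedField]
  have h2 : Module.finrank F L = 1 := finrank_eq_one_of_forall_exists_isRoot fun p _ hp => h p (by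
    rw [hp, h1, ← Nat.not_even_iff_odd, even_iff_two_dvd]
    exact P.not_dvd_index)
  rw [← Module.finrank_mul_finrank F L N, h2, one_mul,
    IntermediateField.finrank_fixedField_eq_card, P.card_eq_multiplicity]
  exact ⟨_, rfl⟩

theorem surjective_algebraMap_of_finrank_eq_two_pow {E N : Type*} [Field E] [Field N] [CharZero E]
    [Algebra E N] [FiniteDimensional E N] [IsGalois E N] (h : ∀ a : E, IsSquare a) {j : ℕ}
    (hj : Module.finrank E N = 2 ^ j) : Function.Surjective (algebraMap E N) := by
  suffices hj0 : j = 0 by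
    rw [hj0, pow_zero] at hj
    exact (Algebra.finrank_eq_one_iff_bijective_algebraMap.1 hj).2
  by_contra hj0
  obtain ⟨i, rfl⟩ := Nat.exists_eq_succ_of_ne_zero hj0
  obtain ⟨H, hH⟩ := Sylow.exists_subgroup_card_pow_prime (G := Gal(N/E)) 2 (n := i) (by
    rw [IsGalois.card_aut_eq_finrank, hj, pow_succ]
    exact dvd_mul_right _ _)
  let L := IntermediateField.fixedField H
  have h1 : Module.finrank E L = 2 := by
    have h2 := Module.finrank_mul_finrank E L N
    rw [IntermediateField.finrank_fixedField_eq_card, hH, hj, pow_succ, mul_comm] at h2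
    exact Nat.eq_of_mul_eq_mul_left (by positivity) h2
  have h3 : Module.finrank E L = 1 := finrank_eq_one_of_forall_exists_isRoot fun p hp hp2 => by
    rw [h1] at hp2
    obtain ⟨s, hs⟩ := h (p.coeff 1 ^ 2 - 4 * p.coeff 0)
    refine ⟨(-p.coeff 1 + s) / 2, ?_⟩
    have hp1 : p.coeff 2 = 1 := by rw [← hp2]; exact hp
    rw [IsRoot, eval_eq_sum_range, hp2]
    simp only [Finset.sum_range_succ, Finset.sum_range_zero, hp1]
    field_simp
    linear_combination -hs
  omega

theorem exists_eq_add_mul_of_mem_adjoin {F N : Type*} [Field F] [Field N] [Algebra F N] {I : N}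
    (hI : I ^ 2 = -1) {z : N} (hz : z ∈ IntermediateField.adjoin F {I}) :
    ∃ a b : F, z = algebraMap F N a + algebraMap F N b * I := by
  have hintegral : IsAlgebraic F I :=
    ⟨X ^ 2 + C 1, (monic_X_pow_add_C 1 two_ne_zero).ne_zero, by simp [hI]⟩
  rw [← IntermediateField.mem_toSubalgebra,
    IntermediateField.adjoin_simple_toSubalgebra_of_isAlgebraic hintegral] at hz
  induction hz using Algebra.adjoin_induction with
  | mem x hx => exact ⟨0, 1, by simpa using hx⟩
  | algebraMap r => exact ⟨r, 0, by simp⟩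
  | add x y _ _ hx hy =>
    obtain ⟨a, b, rfl⟩ := hx
    obtain ⟨c, d, rfl⟩ := hy
    exact ⟨a + c, b + d, by simp only [map_add]; ring⟩
  | mul x y _ _ hx hy =>
    obtain ⟨a, b, rfl⟩ := hx
    obtain ⟨c, d, rfl⟩ := hy
    refine ⟨a * c - b * d, a * d + b * c, ?_⟩
    simp only [map_add, map_sub, map_mul]
    linear_combination algebraMap F N b * algebraMap F N d * hI

theorem exists_sq_eq_of_nonneg {F : Type*} [Field F] [LinearOrder F] [IsStrictOrderedRing F]
    (h : ∀ a : F, 0 ≤ a → IsSquare a) (a b : F) :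
    ∃ u v : F, u ^ 2 - v ^ 2 = a ∧ 2 * u * v = b := by
  have hsqrt : ∀ a : F, 0 ≤ a → ∃ r, 0 ≤ r ∧ r ^ 2 = a := fun a ha => by
    obtain ⟨r, hr⟩ := h a ha
    exact ⟨|r|, abs_nonneg r, by rw [sq_abs, hr, sq]⟩
  obtain ⟨r, hr0, hr⟩ := hsqrt (a ^ 2 + b ^ 2) (by positivity)
  have har : |a| ≤ r := abs_le_of_sq_le_sq (by nlinarith [sq_nonneg b]) hr0
  obtain ⟨h1, h2⟩ := abs_le.1 har
  obtain ⟨u, hu0, hu⟩ := hsqrt ((r + a) / 2) (by linarith)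
  obtain ⟨v, hv0, hv⟩ := hsqrt ((r - a) / 2) (by linarith)
  have huv : (2 * u * v) ^ 2 = b ^ 2 := by
    rw [mul_pow, mul_pow, hu, hv]
    linear_combination hr
  rcases sq_eq_sq_iff_eq_or_eq_neg.1 huv with h3 | h3
  · exact ⟨u, v, by rw [hu, hv]; ring, h3⟩
  · exact ⟨u, -v, by rw [neg_sq, hu, hv]; ring, by linear_combination -h3⟩

/-- The fundamental theorem of algebra over a real closed field. -/
theorem exists_eq_add_mul_of_sq_eq_neg_one {F Ω : Type*} [Field F] [LinearOrder F]
    [IsStrictOrderedRing F] [Field Ω] [Algebra F Ω] [Algebra.IsAlgebraic F Ω] [IsAlgClosed Ω]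
    (hsq : ∀ a : F, 0 ≤ a → IsSquare a) (hodd : ∀ p : F[X], Odd p.natDegree → ∃ r, p.IsRoot r)
    {I : Ω} (hI : I ^ 2 = -1) (z : Ω) :
    ∃ a b : F, z = algebraMap F Ω a + algebraMap F Ω b * I := by
  have : FiniteDimensional F (IntermediateField.adjoin F {z, I}) :=
    IntermediateField.finiteDimensional_adjoin fun x _ => Algebra.IsIntegral.isIntegral x
  let K := IntermediateField.adjoin F {z, I}
  let N := IntermediateField.normalClosure F K Ω
  have : IsAlgClosure F Ω := ⟨inferInstance, inferInstance⟩
  have : Normal F Ω := IsAlgClosure.normal F Ω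
  have : IsGalois F N := ⟨⟩
  have hKN : K ≤ N := IntermediateField.le_normalClosure K
  let z' : N := ⟨z, hKN (IntermediateField.subset_adjoin F _ (by simp))⟩
  let I' : N := ⟨I, hKN (IntermediateField.subset_adjoin F _ (by simp))⟩
  have hI' : I' ^ 2 = -1 := Subtype.ext (by simpa using hI)
  obtain ⟨k, hk⟩ := exists_finrank_eq_two_pow (N := N) hodd
  let E := IntermediateField.adjoin F {I'}
  obtain ⟨j, -, hj⟩ := (Nat.dvd_prime_pow Nat.prime_two).1
    (Dvd.intro_left _ ((Module.finrank_mul_finrank F E N).trans hk))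
  have hE : ∀ w : E, IsSquare w := fun w => by
    obtain ⟨a, b, hab⟩ := exists_eq_add_mul_of_mem_adjoin hI' w.2
    obtain ⟨u, v, h1, h2⟩ := exists_sq_eq_of_nonneg hsq a b
    have hIE : I' ∈ E := IntermediateField.mem_adjoin_simple_self F I'
    refine ⟨algebraMap F E u + algebraMap F E v * ⟨I', hIE⟩, Subtype.ext ?_⟩
    rw [hab, ← h1, ← h2]
    simp only [IntermediateField.coe_mul, IntermediateField.coe_add, map_sub, map_mul, map_pow,
      map_ofNat]
    have h3 : ∀ x : F, ((algebraMap F E x : E) : N) = algebraMap F N x := fun _ => rfl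
    rw [h3, h3]
    linear_combination -(algebraMap F N v ^ 2) * hI'
  obtain ⟨w, hw⟩ := surjective_algebraMap_of_finrank_eq_two_pow hE hj z'
  obtain ⟨a, b, hab⟩ := exists_eq_add_mul_of_mem_adjoin hI' w.2
  refine ⟨a, b, ?_⟩
  have h3 : z' = algebraMap F N a + algebraMap F N b * I' := hw.symm.trans hab
  exact congrArg (Subtype.val : N → Ω) h3

end RealClosure

section ArtinLang

theorem mem_range_of_isAlgebraic_real {F : Type*} [Field F] [LinearOrder F] [IsStrictOrderedRing F]
    [Algebra ℝ F] {a : F} (ha : IsAlgebraic ℝ a) : a ∈ Set.range (algebraMap ℝ F) := by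
  have hintegral := ha.isIntegral
  have hd : (minpoly ℝ a).natDegree ≤ 2 :=
    natDegree_le_of_degree_le (minpoly.irreducible hintegral).degree_le_two
  have hpos := minpoly.natDegree_pos hintegral
  have hroot := minpoly.aeval ℝ a
  have hmon := minpoly.monic hintegral
  rw [aeval_eq_sum_range] at hroot
  simp only [Algebra.smul_def] at hroot
  rcases (by omega : (minpoly ℝ a).natDegree = 1 ∨ (minpoly ℝ a).natDegree = 2) with h | h
  · have h1 : (minpoly ℝ a).coeff 1 = 1 := by rw [← h]; exact hmon
    simp only [h, Finset.sum_range_succ, Finset.sum_range_zero, h1, map_one] at hroot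
    refine ⟨-(minpoly ℝ a).coeff 0, ?_⟩
    rw [map_neg]
    linear_combination -hroot
  have h1 : (minpoly ℝ a).coeff 2 = 1 := by rw [← h]; exact hmon
  simp only [h, Finset.sum_range_succ, Finset.sum_range_zero, h1, map_one] at hroot
  set b := (minpoly ℝ a).coeff 1
  set c := (minpoly ℝ a).coeff 0
  rcases le_total 0 (b ^ 2 / 4 - c) with hD | hD
  · have h2 : (a + algebraMap ℝ F (b / 2)) ^ 2 = algebraMap ℝ F (√(b ^ 2 / 4 - c)) ^ 2 := by
      rw [← map_pow, Real.sq_sqrt hD]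
      simp only [map_sub, map_div₀, map_pow, map_ofNat]
      linear_combination hroot
    rcases sq_eq_sq_iff_eq_or_eq_neg.1 h2 with h3 | h3
    · exact ⟨√(b ^ 2 / 4 - c) - b / 2, by rw [map_sub, ← h3]; ring⟩
    · exact ⟨-√(b ^ 2 / 4 - c) - b / 2, by rw [map_sub, map_neg, ← h3]; ring⟩
  · have h2 : (a + algebraMap ℝ F (b / 2)) ^ 2 + algebraMap ℝ F (√(-(b ^ 2 / 4 - c))) ^ 2 = 0 := by
      rw [← map_pow, Real.sq_sqrt (neg_nonneg.2 hD)]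
      simp only [map_neg, map_sub, map_div₀, map_pow, map_ofNat]
      linear_combination hroot
    have h3 : a + algebraMap ℝ F (b / 2) = 0 := by
      have h4 := sq_nonneg (algebraMap ℝ F (√(-(b ^ 2 / 4 - c))))
      exact pow_eq_zero_iff two_ne_zero |>.1 (le_antisymm (by linarith) (sq_nonneg _))
    exact ⟨-(b / 2), by rw [map_neg]; linear_combination -h3⟩

theorem mem_range_algebraicClosure_of_isAlgebraic {k F : Type*} [Field k] [Field F] [Algebra k F]
    {a : F} (ha : IsAlgebraic (algebraicClosure k F) a) :
    a ∈ Set.range (algebraMap (algebraicClosure k F) F) :=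
  ⟨⟨a, mem_algebraicClosure_iff.2 (ha.restrictScalars k)⟩, rfl⟩

variable {F Ω : Type*} [Field F] [LinearOrder F] [IsStrictOrderedRing F] [Field Ω] [IsAlgClosed Ω]
  [Algebra F Ω] {I : Ω} [Algebra ℝ F]

theorem exists_real_zero_of_mem_algebraicClosure_adjoin (hI : I ^ 2 = -1)
    (hspan : ∀ z : Ω, ∃ a b : F, z = algebraMap F Ω a + algebraMap F Ω b * I)
    {σ : Type*} [Finite σ] (J : Set (MvPolynomial σ ℝ)) (s : Finset F) (x : σ → F)
    (hx : ∀ i, IsAlgebraic (IntermediateField.adjoin ℝ (s : Set F)) (x i))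
    (hJ : ∀ h ∈ J, MvPolynomial.aeval x h = 0) :
    ∃ y : σ → ℝ, ∀ h ∈ J, MvPolynomial.aeval y h = 0 := by
  classical
  induction s using Finset.induction_on generalizing x with
  | empty =>
    have h1 : ∀ i, ∃ r, algebraMap ℝ F r = x i := fun i => by
      refine mem_range_of_isAlgebraic_real (IsAlgebraic.of_forall_mem_range (fun e => ?_) (hx i))
      have h2 : IntermediateField.adjoin ℝ ((∅ : Finset F) : Set F) ≤ ⊥ := by simp
      exact h2 e.2
    choose y hy using h1
    refine ⟨y, fun h hh => (algebraMap ℝ F).injective ?_⟩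
    rw [map_zero, ← hJ h hh, ← MvPolynomial.aeval_algebraMap_apply]
    exact congrArg (fun z => MvPolynomial.aeval z h) (_root_.funext hy)
  | insert t s _ ih =>
    let k := IntermediateField.adjoin ℝ (s : Set F)
    let R := algebraicClosure k F
    have : IsScalarTower ℝ R F := IsScalarTower.of_algebraMap_eq fun _ => rfl
    let J' : Set (MvPolynomial σ R) := MvPolynomial.map (algebraMap ℝ R) '' J
    have hsub : IntermediateField.adjoin ℝ ((insert t s : Finset F) : Set F) ≤
        (IntermediateField.adjoin R {t}).restrictScalars ℝ := by
      rw [IntermediateField.adjoin_le_iff, Finset.coe_insert, Set.insert_subset_iff]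
      refine ⟨IntermediateField.mem_adjoin_simple_self R t, fun a ha => ?_⟩
      have hak : a ∈ k := IntermediateField.subset_adjoin ℝ _ ha
      exact (IntermediateField.adjoin R {t}).algebraMap_mem (algebraMap k R ⟨a, hak⟩)
    obtain ⟨y, hy⟩ := exists_aeval_eq_zero_of_isAlgebraic_adjoin hI hspan (R := R)
      (fun a ha => mem_range_algebraicClosure_of_isAlgebraic ha) t x
      (fun i => IsAlgebraic.of_forall_mem_range (fun e => ⟨⟨e, hsub e.2⟩, rfl⟩) (hx i)) J' (by
        rintro _ ⟨h, hh, rfl⟩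
        rw [MvPolynomial.aeval_map_algebraMap]
        exact hJ h hh)
    refine ih (fun i => (y i : F)) (fun i => mem_algebraicClosure_iff.1 (y i).2) fun h hh => ?_
    have h1 := congrArg (algebraMap R F) (hy _ ⟨h, hh, rfl⟩)
    rw [MvPolynomial.aeval_map_algebraMap, map_zero, ← MvPolynomial.aeval_algebraMap_apply] at h1
    exact h1

end ArtinLang

/-- The Artin–Lang theorem over `ℝ`. -/
theorem exists_real_zero_of_not_isSumSq_neg_one {K : Type*} [Field K] [Algebra ℝ K]
    (hK : ¬ IsSumSq (-1 : K)) {σ : Type*} [Finite σ] (J : Set (MvPolynomial σ ℝ)) (x : σ → K)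
    (hJ : ∀ h ∈ J, MvPolynomial.aeval x h = 0) :
    ∃ y : σ → ℝ, ∀ h ∈ J, MvPolynomial.aeval y h = 0 := by
  classical
  have := Fintype.ofFinite σ
  obtain ⟨F, hF⟩ := exists_isMaximalReal K (AlgebraicClosure K) hK
  obtain ⟨_, _, hsq⟩ := hF.exists_order
  obtain ⟨I, hI⟩ := IsAlgClosed.exists_pow_nat_eq (-1 : AlgebraicClosure K) two_pos
  let _ : Algebra ℝ F := ((algebraMap K F).comp (algebraMap ℝ K)).toAlgebra
  have : IsScalarTower ℝ K F := IsScalarTower.of_algebraMap_eq fun _ => rfl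
  refine exists_real_zero_of_mem_algebraicClosure_adjoin hI
    (exists_eq_add_mul_of_sq_eq_neg_one hsq hF.exists_isRoot_of_odd_natDegree hI) J
    (Finset.univ.image fun i => algebraMap K F (x i)) (fun i => algebraMap K F (x i))
    (fun i => ?_) fun h hh => ?_
  · have hi : algebraMap K F (x i) ∈ IntermediateField.adjoin ℝ
        ((Finset.univ.image fun i => algebraMap K F (x i) : Finset F) : Set F) :=
      IntermediateField.subset_adjoin ℝ _ (by simp)
    exact isAlgebraic_algebraMap (⟨_, hi⟩ : IntermediateField.adjoin ℝ
        ((Finset.univ.image fun i => algebraMap K F (x i) : Finset F) : Set F))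
  · have h1 := congrArg (algebraMap K F) (hJ h hh)
    rw [map_zero, ← MvPolynomial.aeval_algebraMap_apply] at h1
    exact h1

end Polynomial

section RealPrime

/-- An ideal which contains no `p ^ (2 * N) + s` with `s` a sum of squares lies in a real prime
ideal which does not contain `p`. -/
theorem exists_real_prime {A : Type*} [CommRing A] (J : Ideal A) (p : A)
    (h : ∀ (N : ℕ) (s : A), IsSumSq s → p ^ (2 * N) + s ∉ J) :
    ∃ P : Ideal A, P.IsPrime ∧ J ≤ P ∧ p ∉ P ∧
      ∀ d s : A, IsSumSq s → d ^ 2 + s ∈ P → d ∈ P := by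
  have hsq : ∀ N : ℕ, IsSumSq (p ^ (2 * N)) := fun N => by
    rw [two_mul, pow_add]
    exact IsSumSq.mul_self _
  obtain ⟨P, hJP, hP⟩ := zorn_le_nonempty₀
    {P : Ideal A | ∀ (N : ℕ) (s : A), IsSumSq s → p ^ (2 * N) + s ∉ P} (by
      intro c hc hchain y hy
      refine ⟨sSup c, fun N s hs hmem => ?_, fun z hz => le_sSup hz⟩
      obtain ⟨I, hI, hI'⟩ := (Submodule.mem_sSup_of_directed ⟨y, hy⟩ hchain.directedOn).1 hmem
      exact hc hI N s hs hI') J h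
  have hadd : ∀ a ∉ P, ∃ (N : ℕ) (s c : A), IsSumSq s ∧ p ^ (2 * N) + s - c * a ∈ P := by
    intro a ha
    have h1 : P ⊔ Ideal.span {a} ∉
        {P : Ideal A | ∀ (N : ℕ) (s : A), IsSumSq s → p ^ (2 * N) + s ∉ P} := fun hmem =>
      ha (hP.le_of_ge hmem le_sup_left (Ideal.mem_sup_right (Ideal.mem_span_singleton_self a)))
    simp only [Set.mem_ofPred_eq, not_forall, not_not] at h1
    obtain ⟨N, s, hs, hmem⟩ := h1
    obtain ⟨u, hu, v, hv, huv⟩ := Submodule.mem_sup.1 hmem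
    obtain ⟨c, rfl⟩ := Ideal.mem_span_singleton'.1 hv
    exact ⟨N, s, c, hs, by rwa [← huv, add_sub_cancel_right]⟩
  refine ⟨P, ⟨?_, fun {a b} hab => ?_⟩, hJP, ?_, fun d s hs hds => ?_⟩
  · rintro rfl
    exact hP.prop 0 0 IsSumSq.zero trivial
  · by_contra! hcon
    obtain ⟨N, s, c, hs, h1⟩ := hadd a hcon.1
    obtain ⟨M, t, e, ht, h2⟩ := hadd b hcon.2
    refine hP.prop (N + M) (p ^ (2 * N) * t + s * p ^ (2 * M) + s * t)
      ((((hsq N).mul ht).add (hs.mul (hsq M))).add (hs.mul ht)) ?_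
    have h3 := P.add_mem (P.add_mem (P.mul_mem_right (p ^ (2 * M) + t) h1)
      (P.mul_mem_left (c * a) h2)) (P.mul_mem_left (c * e) hab)
    convert h3 using 1
    ring
  · intro hp
    refine hP.prop 1 0 IsSumSq.zero ?_
    rw [add_zero]
    exact Ideal.pow_mem_of_mem P hp _ (by norm_num)
  · by_contra hd
    obtain ⟨N, t, c, ht, h1⟩ := hadd d hd
    refine hP.prop (2 * N) (p ^ (2 * N) * t + p ^ (2 * N) * t + t * t + c * c * s)
      (((((hsq N).mul ht).add ((hsq N).mul ht)).add (ht.mul ht)).add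
        ((IsSumSq.mul_self c).mul hs)) ?_
    have h3 := P.add_mem (P.mul_mem_right (p ^ (2 * N) + t + c * d) h1)
      (P.mul_mem_left (c * c) hds)
    convert h3 using 1
    ring

theorem not_isSumSq_neg_one_of_real_prime {A K : Type*} [CommRing A] [Field K] {P : Ideal A}
    [P.IsPrime] (hP : ∀ d s : A, IsSumSq s → d ^ 2 + s ∈ P → d ∈ P)
    [Algebra (A ⧸ P) K] [IsFractionRing (A ⧸ P) K] : ¬ IsSumSq (-1 : K) := by
  let φ : A →+* K := (algebraMap (A ⧸ P) K).comp (Ideal.Quotient.mk P)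
  have hφ : ∀ a, φ a = 0 ↔ a ∈ P := fun a => by
    simp [φ, Ideal.Quotient.eq_zero_iff_mem]
  have hsurj : ∀ z : K, ∃ a d : A, d ∉ P ∧ z * φ d = φ a := fun z => by
    obtain ⟨a, d, hd, rfl⟩ := IsFractionRing.div_surjective (A := A ⧸ P) z
    obtain ⟨a, rfl⟩ := Ideal.Quotient.mk_surjective a
    obtain ⟨d, rfl⟩ := Ideal.Quotient.mk_surjective d
    have hd0 := nonZeroDivisors.ne_zero hd
    have hdP : d ∉ P := fun h => hd0 (Ideal.Quotient.eq_zero_iff_mem.2 h)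
    exact ⟨a, d, hdP, div_mul_cancel₀ _ fun h => hdP ((hφ d).1 h)⟩
  have key : ∀ z : K, IsSumSq z → ∃ d s : A, d ∉ P ∧ IsSumSq s ∧ z * φ d ^ 2 = φ s := by
    intro z hz
    induction hz with
    | zero => exact ⟨1, 0, (Ideal.ne_top_iff_one P).1 Ideal.IsPrime.ne_top', IsSumSq.zero, by simp⟩
    | sq_add a _ ih =>
      obtain ⟨d, s, hd, hs, h1⟩ := ih
      obtain ⟨b, e, he, h2⟩ := hsurj a
      refine ⟨d * e, (d * b) * (d * b) + e * e * s, fun h => ?_,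
        ((IsSumSq.mul_self e).mul hs).sq_add _, ?_⟩
      · exact (Ideal.IsPrime.mem_or_mem ‹_› h).elim hd he
      · simp only [map_add, map_mul, ← h1, ← h2]
        ring
  intro h
  obtain ⟨d, s, hd, hs, h1⟩ := key _ h
  refine hd (hP d s hs ((hφ _).1 ?_))
  rw [map_add, map_pow, ← h1]
  ring

end RealPrime

/-- The real Nullstellensatz over `ℝ`. -/
theorem exists_pow_add_mem_of_forall_eval_eq_zero {σ : Type*} [Finite σ]
    (J : Ideal (MvPolynomial σ ℝ)) (p : MvPolynomial σ ℝ)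
    (hp : ∀ x : σ → ℝ, (∀ q ∈ J, eval x q = 0) → eval x p = 0) :
    ∃ (N : ℕ) (s : MvPolynomial σ ℝ), IsSumSq s ∧ p ^ (2 * N) + s ∈ J := by
  by_contra! hcon
  obtain ⟨P, _, hJP, hpP, hP⟩ := exists_real_prime J p hcon
  let K := FractionRing (MvPolynomial σ ℝ ⧸ P)
  let φ : MvPolynomial σ ℝ →ₐ[ℝ] K := (IsScalarTower.toAlgHom ℝ (MvPolynomial σ ℝ ⧸ P) K).comp
    (Ideal.Quotient.mkₐ ℝ P)
  have hφ : ∀ q, φ q = 0 ↔ q ∈ P := fun q => by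
    refine (map_eq_zero_iff (algebraMap (MvPolynomial σ ℝ ⧸ P) K)
      (IsFractionRing.injective _ K)).trans ?_
    exact Ideal.Quotient.eq_zero_iff_mem
  have hφx : ∀ q, aeval (fun i => φ (X i)) q = φ q := fun q =>
    congrArg (fun g : MvPolynomial σ ℝ →ₐ[ℝ] K => g q) (aeval_unique φ).symm
  have hp0 : φ p ≠ 0 := fun h => hpP ((hφ p).1 h)
  obtain ⟨y, hy⟩ := Polynomial.exists_real_zero_of_not_isSumSq_neg_one
    (not_isSumSq_neg_one_of_real_prime (K := K) hP)
    (insert (X none * rename some p - 1) (rename some '' (J : Set (MvPolynomial σ ℝ))))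
    (fun i : Option σ => i.elim (φ p)⁻¹ fun i => φ (X i)) (by
      rintro _ (rfl | ⟨q, hq, rfl⟩)
      · rw [map_sub, map_mul, aeval_X, aeval_rename, map_one]
        change (φ p)⁻¹ * aeval (fun i => φ (X i)) p - 1 = 0
        rw [hφx, inv_mul_cancel₀ hp0, sub_self]
      · rw [aeval_rename]
        change aeval (fun i => φ (X i)) q = 0
        rw [hφx, hφ]
        exact hJP hq)
  have h1 : eval y (X none * rename some p - 1) = 0 := by
    rw [← coe_aeval_eq_eval]
    exact hy _ (Set.mem_insert _ _)
  have h2 : eval (y ∘ some) p = 0 := hp _ fun q hq => by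
    have := hy _ (Set.mem_insert_of_mem _ ⟨q, hq, rfl⟩)
    rwa [aeval_rename, aeval_eq_eval] at this
  rw [map_sub, map_mul, eval_rename, h2] at h1
  simp at h1

theorem isSOS_iff_isSumSq {σ : Type*} {p : MvPolynomial σ ℝ} : IsSOS p ↔ IsSumSq p := by
  constructor
  · rintro ⟨k, q, rfl⟩
    exact IsSumSq.sum_sq _ _
  · intro h
    induction h with
    | zero => exact ⟨0, Fin.elim0, by simp⟩
    | sq_add a _ ih =>
      obtain ⟨k, q, rfl⟩ := ih
      exact ⟨k + 1, Fin.cons a q, by simp [Fin.sum_univ_succ, sq]⟩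

theorem isSumSq_algebraMap_mul {A : Type*} [CommRing A] [Algebra ℝ A] {r : ℝ} (hr : 0 ≤ r) {a : A}
    (ha : IsSumSq a) : IsSumSq (algebraMap ℝ A r * a) := by
  rw [← Real.mul_self_sqrt hr, map_mul]
  exact (IsSumSq.mul_self _).mul ha

theorem isSumSq_one_sub_add_pow {A : Type*} [CommRing A] [Algebra ℝ A] (j : ℕ) (a : A) :
    IsSumSq (1 - a + algebraMap ℝ A (2⁻¹ ^ j) * a ^ 2 ^ j) := by
  induction j generalizing a with
  | zero => simp
  | succ j ih =>
    have h1 := isSumSq_algebraMap_mul (r := 2⁻¹) (by norm_num) ((ih (a ^ 2)).sq_add (1 - a))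
    convert h1 using 1
    have h2 : algebraMap ℝ A 2⁻¹ * 2 = 1 := by
      rw [← map_ofNat (algebraMap ℝ A) 2, ← map_mul]
      norm_num
    rw [← pow_mul, ← pow_succ', pow_succ, map_mul]
    linear_combination (a - 1) * h2

/-- If `f̄* = inf {f(x) : x ∈ S(g) ∩ V(h)}` is a real number and there is `q ∈ Q(g)` such
that `f − f̄* − q` vanishes on `V(h)`, then the SOS relaxation is exact at some finite
order: `ρ_k(f, g, h) = f̄*` for some `k`. -/
theorem finite_convergence_of_rep {n m l : ℕ} (f : MvPolynomial (Fin n) ℝ)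
    (g : Fin m → MvPolynomial (Fin n) ℝ) (h : Fin l → MvPolynomial (Fin n) ℝ)
    (fstar : ℝ)
    (hglb : IsGLB ((fun x => eval x f) '' (Sg g ∩ Vh h)) fstar)
    (q : MvPolynomial (Fin n) ℝ) (hq : InQM g q)
    (hvan : ∀ x ∈ Vh h, eval x (f - C fstar - q) = 0) :
    ∃ k : ℕ, rho k f g h = fstar := by
  let p := f - C fstar - q
  obtain ⟨N, s, hs, hmem⟩ := exists_pow_add_mem_of_forall_eval_eq_zero (Ideal.span (Set.range h)) p
    fun x hx => hvan x fun t => hx _ (Ideal.subset_span ⟨t, rfl⟩)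
  obtain ⟨σ, hσ, hmem⟩ : ∃ σ, IsSumSq σ ∧ p ^ 2 ^ (N + 1) + σ ∈ Ideal.span (Set.range h) := by
    have h1 : 2 ^ (N + 1) = 2 * N + (2 ^ N - N) + (2 ^ N - N) := by
      have := N.lt_two_pow_self
      omega
    refine ⟨p ^ (2 ^ N - N) * p ^ (2 ^ N - N) * s, (IsSumSq.mul_self _).mul hs, ?_⟩
    convert Ideal.mul_mem_left _ (p ^ (2 ^ N - N) * p ^ (2 ^ N - N)) hmem using 1
    rw [h1]
    ring
  set e := 2 ^ (N + 1) with he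
  obtain ⟨ψ, hψ⟩ := (Ideal.mem_span_range_iff_exists_fun).1 hmem
  obtain ⟨q0, w, hq0, hw, rfl⟩ := hq
  let k := q0.totalDegree + e * p.totalDegree + p.totalDegree + σ.totalDegree +
    ∑ j, (w j * g j).totalDegree + ∑ t, (ψ t * h t).totalDegree
  refine ⟨k, ?_⟩
  have hj : ∀ j, (w j * g j).totalDegree ≤ 2 * k := fun j => by
    have := Finset.single_le_sum (f := fun j => (w j * g j).totalDegree)
      (fun _ _ => Nat.zero_le _) (Finset.mem_univ j)
    omega
  have ht : ∀ t, (ψ t * h t).totalDegree ≤ 2 * k := fun t => by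
    have := Finset.single_le_sum (f := fun t => (ψ t * h t).totalDegree)
      (fun _ _ => Nat.zero_le _) (Finset.mem_univ t)
    omega
  have hfeas : ∀ ε > 0, fstar - ε ∈ {ξ : ℝ | ∃ q1 q2, InTruncQM k g q1 ∧ InTruncId k h q2 ∧
      f - C ξ = q1 + q2} := by
    intro ε hε
    let c : ℝ := ε * (2⁻¹ ^ (N + 1) * ε⁻¹ ^ e)
    have hc : 0 ≤ c := by positivity
    let τ := C ε + p + C c * p ^ e
    have hτ : IsSumSq τ := by
      suffices h : τ = C ε * (1 - -(C ε⁻¹ * p) + C (2⁻¹ ^ (N + 1)) * (-(C ε⁻¹ * p)) ^ e) by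
        rw [h]
        exact isSumSq_algebraMap_mul hε.le (isSumSq_one_sub_add_pow (N + 1) (-(C ε⁻¹ * p)))
      have h1 : (C ε * C ε⁻¹ : MvPolynomial (Fin n) ℝ) = 1 := by
        rw [← C_mul, mul_inv_cancel₀ hε.ne', C_1]
      rw [Even.neg_pow (by rw [he, pow_succ]; exact even_two.mul_left _), mul_pow]
      simp only [τ, c, C_mul, C_pow]
      linear_combination -p * h1
    refine ⟨(q0 + τ + C c * σ) + ∑ j, w j * g j, ∑ t, (-(C c * ψ t)) * h t,
      ⟨_, w, ?_, hw, ?_, hj, rfl⟩, ⟨_, fun t => ?_, rfl⟩, ?_⟩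
    · rw [isSOS_iff_isSumSq] at hq0 ⊢
      exact (hq0.add hτ).add (isSumSq_algebraMap_mul hc hσ)
    · have hC : ∀ (r : ℝ) (u : MvPolynomial (Fin n) ℝ), u.totalDegree ≤ 2 * k →
          (C r * u).totalDegree ≤ 2 * k := fun r u hu => by
        rw [C_mul']
        exact (totalDegree_smul_le _ _).trans hu
      have hadd : ∀ u v : MvPolynomial (Fin n) ℝ, u.totalDegree ≤ 2 * k → v.totalDegree ≤ 2 * k →
          (u + v).totalDegree ≤ 2 * k := fun u v hu hv =>
        (totalDegree_add _ _).trans (max_le hu hv)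
      refine hadd _ _ (hadd _ _ (by omega) (hadd _ _ (hadd _ _ ?_ (by omega))
        (hC _ _ ((totalDegree_pow _ _).trans (by omega))))) (hC _ _ (by omega))
      rw [totalDegree_C]
      exact Nat.zero_le _
    · rw [show -(C c * ψ t) * h t = (-c) • (ψ t * h t) by rw [smul_eq_C_mul, C_neg]; ring]
      exact (totalDegree_smul_le _ _).trans (ht t)
    · have h1 : ∑ t, -(C c * ψ t) * h t = -(C c * (p ^ e + σ)) := by
        rw [← hψ, Finset.mul_sum, ← Finset.sum_neg_distrib]
        exact Finset.sum_congr rfl fun t _ => by ring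
      rw [h1]
      simp only [τ, C_sub]
      have h2 : f = p + C fstar + (q0 + ∑ j, w j * g j) := by simp only [p]; ring
      linear_combination h2
  obtain ⟨_, x, ⟨hxg, hxh⟩, -⟩ := hglb.nonempty
  refine csSup_eq_of_forall_le_of_forall_lt_exists_gt ⟨_, hfeas 1 one_pos⟩ ?_ fun r hr =>
    ⟨_, hfeas ((fstar - r) / 2) (by linarith), by linarith⟩
  rintro ξ ⟨_, _, ⟨s0, s, hs0, hs, -, -, rfl⟩, ⟨ψ, -, rfl⟩, hξ⟩
  refine hglb.2 ?_
  rintro _ ⟨x, ⟨hxg, hxh⟩, rfl⟩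
  have hnonneg : ∀ u : MvPolynomial (Fin n) ℝ, IsSOS u → 0 ≤ eval x u := by
    rintro _ ⟨k, v, rfl⟩
    rw [map_sum]
    exact Finset.sum_nonneg fun i _ => by rw [map_pow]; positivity
  have h1 := congrArg (eval x) hξ
  simp only [map_sub, map_add, map_sum, map_mul, eval_C, hxh _, mul_zero, Finset.sum_const_zero,
    add_zero] at h1
  have h2 : 0 ≤ ∑ j, eval x (s j) * eval x (g j) :=
    Finset.sum_nonneg fun j _ => mul_nonneg (hnonneg _ (hs j)) (hxg j)
  have h3 := hnonneg _ hs0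
  simp only
  linarith
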